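/- p-q-r Lemma: let f : A ⊢ B be an arrow of DS, let x₁, x₂, x₃ be occurrences of the letters p, q and r respectively in A, and let y₁, y₂, y₃ be occurrences of p, q and r respectively in B, such that x_i and y_i are linked in f for i ∈ {1,2,3}. Suppose moreover that x₂ ∨ x₃ is a subformula occurrence of A and y₁ ∧ y₂ is a subformula occurrence of B. Then there is a d_{p,q,r}-term h : A′ ⊢ B′, with x′_i the occurrences of p, q, r in the source p∧(q∨r) of the head of h and y′_i the occurrences of p, q, r in the target (p∧q)∨r of the head of h, and there are arrows f_x : A ⊢ A′ and f_y : B′ ⊢ B of DS, such that f = f_y ∘ h ∘ f_x in DS, x_i is linked to x′_i in f_x, and y′_i is linked to y_i in f_y, for i ∈ {1,2,3}. -/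

import Mathlib

/-! ### The category Br of Brauerian split equivalences of finite ordinals

An arrow `m ⊢ n` of `Br` is represented as a relation on `ℕ ⊕ ℕ`, where
`Sum.inl i` (with `i < m`) is the source copy `i_s` and `Sum.inr j`
(with `j < n`) is the target copy `j_t`. -/

abbrev GRel : Type := (ℕ ⊕ ℕ) → (ℕ ⊕ ℕ) → Prop

/-- The identity arrow of `Br` on `n`: transversals `{i_s, i_t}` for `i < n`. -/
def gId (n : ℕ) : GRel := fun u v =>
  ∃ i, i < n ∧ (u = Sum.inl i ∨ u = Sum.inr i) ∧ (v = Sum.inl i ∨ v = Sum.inr i)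

/-- The Brauerian split equivalence whose transversals are `{i_s, (φ i)_t}` for `i < m`. -/
def gFun (m : ℕ) (φ : ℕ → ℕ) : GRel := fun u v =>
  ∃ i, i < m ∧ (u = Sum.inl i ∨ u = Sum.inr (φ i)) ∧ (v = Sum.inl i ∨ v = Sum.inr (φ i))

/-- The block transposition exchanging the first `a` and the last `b` elements. -/
def gSwap (a b : ℕ) : GRel :=
  gFun (a + b) (fun i => if i < a then i + b else i - a)

/-- `G Δ̂∧_{B,A}` with `a = GA`, `b = GB`: identity transversals on the stem `A`
together with caps joining the two copies of each letter occurrence of `B` in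
the crown `¬B ∨ B` of the target. -/
def gDelta (a b : ℕ) : GRel := fun u v =>
  (∃ i, i < a ∧ (u = Sum.inl i ∨ u = Sum.inr i) ∧ (v = Sum.inl i ∨ v = Sum.inr i)) ∨
  (∃ j, j < b ∧ (u = Sum.inr (a + j) ∨ u = Sum.inr (a + b + j)) ∧
                (v = Sum.inr (a + j) ∨ v = Sum.inr (a + b + j)))

/-- `G Σ̂∨_{B,A}` with `a = GA`, `b = GB`: identity transversals on the stem `A`
together with cups joining the two copies of each letter occurrence of `B` in
the crown `B ∧ ¬B` of the source. -/
def gSigma (a b : ℕ) : GRel := fun u v =>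
  (∃ i, i < a ∧ (u = Sum.inl (2*b + i) ∨ u = Sum.inr i) ∧
                (v = Sum.inl (2*b + i) ∨ v = Sum.inr i)) ∨
  (∃ j, j < b ∧ (u = Sum.inl j ∨ u = Sum.inl (b + j)) ∧
                (v = Sum.inl j ∨ v = Sum.inl (b + j)))

/-- Composition `P ∗ R` in `Br`: glue along the middle copy and take the
transitive closure, restricted to the outer copies. -/
def gComp (Pr R : GRel) : GRel := fun u v =>
  Relation.TransGen
    (fun x y : ℕ ⊕ ℕ ⊕ ℕ =>
      (∃ x' y', Sum.map id Sum.inl x' = x ∧ Sum.map id Sum.inl y' = y ∧ R x' y') ∨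
      (∃ x' y', Sum.inr x' = x ∧ Sum.inr y' = y ∧ Pr x' y'))
    (Sum.map id Sum.inr u) (Sum.map id Sum.inr v)

/-- Shift a split relation by `a` on the source side and by `d` on the target side. -/
def gShift (a d : ℕ) (R : GRel) : GRel := fun u v =>
  ∃ u' v', R u' v' ∧ u = Sum.map (· + a) (· + d) u' ∧ v = Sum.map (· + a) (· + d) v'

/-- Disjoint union of split relations: `G(f ξ g) = Gf ∪ Gg_{+GD}^{+GA}`. -/
def gPar (a d : ℕ) (R S : GRel) : GRel := fun u v => R u v ∨ gShift a d S u v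
/-! ### The language L∧,∨ generated from the set `P` of letters -/

inductive Form (P : Type) : Type
  | letter : P → Form P
  | conj : Form P → Form P → Form P
  | disj : Form P → Form P → Form P

infixr:70 " ⋏ " => Form.conj
infixr:66 " ⋎ " => Form.disj

/-- The number of occurrences of letters in a formula (the object map of `G`). -/
def Form.size {P : Type} : Form P → ℕ
  | .letter _ => 1
  | .conj A B => A.size + B.size
  | .disj A B => A.size + B.size
/-! ### Arrow terms of the free symmetric net category DS -/

inductive Term (P : Type) : Form P → Form P → Type
  | id (A : Form P) : Term P A A
  | comp {A B C : Form P} : Term P B C → Term P A B → Term P A C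
  | conj {A B D E : Form P} : Term P A D → Term P B E → Term P (A ⋏ B) (D ⋏ E)
  | disj {A B D E : Form P} : Term P A D → Term P B E → Term P (A ⋎ B) (D ⋎ E)
  | bConjTo (A B C : Form P) : Term P (A ⋏ (B ⋏ C)) ((A ⋏ B) ⋏ C)
  | bConjFrom (A B C : Form P) : Term P ((A ⋏ B) ⋏ C) (A ⋏ (B ⋏ C))
  | bDisjTo (A B C : Form P) : Term P (A ⋎ (B ⋎ C)) ((A ⋎ B) ⋎ C)
  | bDisjFrom (A B C : Form P) : Term P ((A ⋎ B) ⋎ C) (A ⋎ (B ⋎ C))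
  | cConj (A B : Form P) : Term P (A ⋏ B) (B ⋏ A)
  | cDisj (A B : Form P) : Term P (B ⋎ A) (A ⋎ B)
  | d (A B C : Form P) : Term P (A ⋏ (B ⋎ C)) ((A ⋏ B) ⋎ C)

infixr:80 " ⬝ " => Term.comp
infixr:70 " ⊼ " => Term.conj
infixr:66 " ⊽ " => Term.disj

/-- The arrow `d^R_{C,B,A} : (C∨B)∧A ⊢ C∨(B∧A)`. -/
def dR {P : Type} (C B A : Form P) : Term P ((C ⋎ B) ⋏ A) (C ⋎ (B ⋏ A)) :=
  Term.cDisj C (B ⋏ A) ⬝ ((Term.cConj A B ⊽ Term.id C) ⬝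
    (Term.d A B C ⬝ ((Term.id A ⊼ Term.cDisj B C) ⬝ Term.cConj (C ⋎ B) A)))
/-! ### The equations of DS, imposed on arrow terms -/

inductive Eqv {P : Type} : ∀ {A B : Form P}, Term P A B → Term P A B → Prop
  -- equivalence and congruence
  | refl {A B : Form P} (f : Term P A B) : Eqv f f
  | symm {A B : Form P} {f g : Term P A B} : Eqv f g → Eqv g f
  | trans {A B : Form P} {f g h : Term P A B} : Eqv f g → Eqv g h → Eqv f h
  | congComp {A B C : Form P} {g g' : Term P B C} {f f' : Term P A B} :
      Eqv g g' → Eqv f f' → Eqv (g ⬝ f) (g' ⬝ f')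
  | congConj {A B D E : Form P} {f f' : Term P A D} {g g' : Term P B E} :
      Eqv f f' → Eqv g g' → Eqv (f ⊼ g) (f' ⊼ g')
  | congDisj {A B D E : Form P} {f f' : Term P A D} {g g' : Term P B E} :
      Eqv f f' → Eqv g g' → Eqv (f ⊽ g) (f' ⊽ g')
  -- (cat 1), (cat 2)
  | catIdR {A B : Form P} (f : Term P A B) : Eqv (f ⬝ Term.id A) f
  | catIdL {A B : Form P} (f : Term P A B) : Eqv (Term.id B ⬝ f) f
  | catAssoc {A B C D : Form P} (f : Term P A B) (g : Term P B C) (h : Term P C D) :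
      Eqv (h ⬝ (g ⬝ f)) ((h ⬝ g) ⬝ f)
  -- bifunctorial equations (ξ 1), (ξ 2)
  | conjOne (A B : Form P) : Eqv (Term.id A ⊼ Term.id B) (Term.id (A ⋏ B))
  | disjOne (A B : Form P) : Eqv (Term.id A ⊽ Term.id B) (Term.id (A ⋎ B))
  | conjTwo {A₁ B₁ C₁ A₂ B₂ C₂ : Form P} (g₁ : Term P B₁ C₁) (f₁ : Term P A₁ B₁)
      (g₂ : Term P B₂ C₂) (f₂ : Term P A₂ B₂) :
      Eqv ((g₁ ⬝ f₁) ⊼ (g₂ ⬝ f₂)) ((g₁ ⊼ g₂) ⬝ (f₁ ⊼ f₂))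
  | disjTwo {A₁ B₁ C₁ A₂ B₂ C₂ : Form P} (g₁ : Term P B₁ C₁) (f₁ : Term P A₁ B₁)
      (g₂ : Term P B₂ C₂) (f₂ : Term P A₂ B₂) :
      Eqv ((g₁ ⬝ f₁) ⊽ (g₂ ⬝ f₂)) ((g₁ ⊽ g₂) ⬝ (f₁ ⊽ f₂))
  -- naturality equations
  | bConjNat {A B C D E F : Form P} (f : Term P A D) (g : Term P B E) (h : Term P C F) :
      Eqv (((f ⊼ g) ⊼ h) ⬝ Term.bConjTo A B C) (Term.bConjTo D E F ⬝ (f ⊼ (g ⊼ h)))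
  | bDisjNat {A B C D E F : Form P} (f : Term P A D) (g : Term P B E) (h : Term P C F) :
      Eqv (((f ⊽ g) ⊽ h) ⬝ Term.bDisjTo A B C) (Term.bDisjTo D E F ⬝ (f ⊽ (g ⊽ h)))
  | cConjNat {A B D E : Form P} (f : Term P A D) (g : Term P B E) :
      Eqv ((g ⊼ f) ⬝ Term.cConj A B) (Term.cConj D E ⬝ (f ⊼ g))
  | cDisjNat {A B D E : Form P} (f : Term P A D) (g : Term P B E) :
      Eqv ((g ⊽ f) ⬝ Term.cDisj B A) (Term.cDisj E D ⬝ (f ⊽ g))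
  | dNat {A B C D E F : Form P} (f : Term P A D) (g : Term P B E) (h : Term P C F) :
      Eqv (((f ⊼ g) ⊽ h) ⬝ Term.d A B C) (Term.d D E F ⬝ (f ⊼ (g ⊽ h)))
  -- (b̂ξ b̂ξ)
  | bConjIso₁ (A B C : Form P) :
      Eqv (Term.bConjFrom A B C ⬝ Term.bConjTo A B C) (Term.id (A ⋏ (B ⋏ C)))
  | bConjIso₂ (A B C : Form P) :
      Eqv (Term.bConjTo A B C ⬝ Term.bConjFrom A B C) (Term.id ((A ⋏ B) ⋏ C))
  | bDisjIso₁ (A B C : Form P) :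
      Eqv (Term.bDisjFrom A B C ⬝ Term.bDisjTo A B C) (Term.id (A ⋎ (B ⋎ C)))
  | bDisjIso₂ (A B C : Form P) :
      Eqv (Term.bDisjTo A B C ⬝ Term.bDisjFrom A B C) (Term.id ((A ⋎ B) ⋎ C))
  -- (b̂ξ 5)
  | bConjPent (A B C D : Form P) :
      Eqv (Term.bConjFrom A B (C ⋏ D) ⬝ Term.bConjFrom (A ⋏ B) C D)
        ((Term.id A ⊼ Term.bConjFrom B C D) ⬝
          (Term.bConjFrom A (B ⋏ C) D ⬝ (Term.bConjFrom A B C ⊼ Term.id D)))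
  | bDisjPent (A B C D : Form P) :
      Eqv (Term.bDisjFrom A B (C ⋎ D) ⬝ Term.bDisjFrom (A ⋎ B) C D)
        ((Term.id A ⊽ Term.bDisjFrom B C D) ⬝
          (Term.bDisjFrom A (B ⋎ C) D ⬝ (Term.bDisjFrom A B C ⊽ Term.id D)))
  -- (ĉ∧ ĉ∧), (ĉ∨ ĉ∨)
  | cConjIso (A B : Form P) : Eqv (Term.cConj B A ⬝ Term.cConj A B) (Term.id (A ⋏ B))
  | cDisjIso (A B : Form P) : Eqv (Term.cDisj A B ⬝ Term.cDisj B A) (Term.id (A ⋎ B))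
  -- (b̂∧ ĉ∧), (b̂∨ ĉ∨)
  | bcConj (A B C : Form P) :
      Eqv ((Term.id B ⊼ Term.cConj C A) ⬝ (Term.bConjFrom B C A ⬝
            (Term.cConj A (B ⋏ C) ⬝ (Term.bConjFrom A B C ⬝ (Term.cConj B A ⊼ Term.id C)))))
        (Term.bConjFrom B A C)
  | bcDisj (A B C : Form P) :
      Eqv ((Term.id B ⊽ Term.cDisj A C) ⬝ (Term.bDisjFrom B C A ⬝
            (Term.cDisj (B ⋎ C) A ⬝ (Term.bDisjFrom A B C ⬝ (Term.cDisj A B ⊽ Term.id C)))))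
        (Term.bDisjFrom B A C)
  -- (d ∧), (d ∨)
  | dConj (A B C D : Form P) :
      Eqv ((Term.bConjFrom A B C ⊽ Term.id D) ⬝ Term.d (A ⋏ B) C D)
        (Term.d A (B ⋏ C) D ⬝ ((Term.id A ⊼ Term.d B C D) ⬝ Term.bConjFrom A B (C ⋎ D)))
  | dDisj (D C B A : Form P) :
      Eqv (Term.d D C (B ⋎ A) ⬝ (Term.id D ⊼ Term.bDisjFrom C B A))
        (Term.bDisjFrom (D ⋏ C) B A ⬝ ((Term.d D C B ⊽ Term.id A) ⬝ Term.d D (C ⋎ B) A))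
  -- (d b̂∧), (d b̂∨)
  | dBConj (A B C D : Form P) :
      Eqv (dR (A ⋏ B) C D ⬝ (Term.d A B C ⊼ Term.id D))
        (Term.d A B (C ⋏ D) ⬝ ((Term.id A ⊼ dR B C D) ⬝ Term.bConjFrom A (B ⋎ C) D))
  | dBDisj (D C B A : Form P) :
      Eqv ((Term.id D ⊽ Term.d C B A) ⬝ dR D C (B ⋎ A))
        (Term.bDisjFrom D (C ⋏ B) A ⬝ ((dR D C B ⊽ Term.id A) ⬝ Term.d (D ⋎ C) B A))
/-- The functor `G` from DS to Br on arrow terms. -/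
def Term.G {P : Type} : ∀ {A B : Form P}, Term P A B → GRel
  | _, _, .id A => gId A.size
  | _, _, .comp g f => gComp (Term.G g) (Term.G f)
  | _, _, @Term.conj _ A _ D _ f g => gPar A.size D.size (Term.G f) (Term.G g)
  | _, _, @Term.disj _ A _ D _ f g => gPar A.size D.size (Term.G f) (Term.G g)
  | _, _, .bConjTo A B C => gId (A.size + (B.size + C.size))
  | _, _, .bConjFrom A B C => gId (A.size + B.size + C.size)
  | _, _, .bDisjTo A B C => gId (A.size + (B.size + C.size))
  | _, _, .bDisjFrom A B C => gId (A.size + B.size + C.size)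
  | _, _, .cConj A B => gSwap A.size B.size
  | _, _, .cDisj A B => gSwap B.size A.size
  | _, _, .d A B C => gId (A.size + (B.size + C.size))
/-! ### Occurrences of letters and subformula occurrences -/

/-- The letter at the `(n+1)`-th letter-occurrence position of a formula
(`n` counted from `0`, from the left). -/
def Form.letterAt {P : Type} : Form P → ℕ → Option P
  | .letter p, 0 => some p
  | .letter _, _ + 1 => none
  | .conj A B, n => if n < A.size then A.letterAt n else B.letterAt (n - A.size)
  | .disj A B, n => if n < A.size then A.letterAt n else B.letterAt (n - A.size)

/-- Directions for addressing subformula occurrences. -/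
inductive Dir : Type
  | l
  | r
deriving DecidableEq

/-- The subformula occurrence of a formula at a given position (path). -/
def Form.subAt {P : Type} : Form P → List Dir → Option (Form P)
  | A, [] => some A
  | .conj A _, .l :: π => A.subAt π
  | .conj _ B, .r :: π => B.subAt π
  | .disj A _, .l :: π => A.subAt π
  | .disj _ B, .r :: π => B.subAt π
  | .letter _, _ :: _ => none

/-- The number of letter occurrences strictly to the left of the subformula
occurrence at a given position. -/
def Form.offsetAt {P : Type} : Form P → List Dir → ℕ
  | _, [] => 0
  | .conj A _, .l :: π => A.offsetAt π
  | .conj A B, .r :: π => A.size + B.offsetAt π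
  | .disj A _, .l :: π => A.offsetAt π
  | .disj A B, .r :: π => A.size + B.offsetAt π
  | .letter _, _ :: _ => 0

/-- The `(n+1)`-th occurrence of a letter in `A` is *linked* in `f : A ⊢ B` to the
`(m+1)`-th occurrence of the same letter in `B` when `{n_s, m_t}` is a member of
the partition corresponding to `Gf`. -/
def Linked {P : Type} {A B : Form P} (f : Term P A B) (n m : ℕ) : Prop :=
  Term.G f (Sum.inl n) (Sum.inr m)
/-! ### Contexts (formulae with a single hole), used to describe β-terms -/

inductive Ctx (P : Type) : Type
  | hole : Ctx P
  | conjL : Ctx P → Form P → Ctx P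
  | conjR : Form P → Ctx P → Ctx P
  | disjL : Ctx P → Form P → Ctx P
  | disjR : Form P → Ctx P → Ctx P

/-- Applying a context to a formula. -/
def Ctx.fill {P : Type} : Ctx P → Form P → Form P
  | .hole, A => A
  | .conjL Z C, A => Z.fill A ⋏ C
  | .conjR C Z, A => C ⋏ Z.fill A
  | .disjL Z C, A => Z.fill A ⋎ C
  | .disjR C Z, A => C ⋎ Z.fill A

/-- Applying a context to an arrow term: `Z(f)` is a β-term when `f` is primitive,
with head `f`. -/
def Ctx.fillArrow {P : Type} {A B : Form P} :
    (Z : Ctx P) → Term P A B → Term P (Z.fill A) (Z.fill B)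
  | .hole, f => f
  | .conjL Z C, f => Z.fillArrow f ⊼ Term.id C
  | .conjR C Z, f => Term.id C ⊼ Z.fillArrow f
  | .disjL Z C, f => Z.fillArrow f ⊽ Term.id C
  | .disjR C Z, f => Term.id C ⊽ Z.fillArrow f

/-- The number of letter occurrences strictly to the left of the hole. -/
def Ctx.offset {P : Type} : Ctx P → ℕ
  | .hole => 0
  | .conjL Z _ => Z.offset
  | .conjR C Z => C.size + Z.offset
  | .disjL Z _ => Z.offset
  | .disjR C Z => C.size + Z.offset


/-! ### Positions of letters and the action of arrow terms on them -/

inductive Pos {P : Type} : Form P → Type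
  | here (p : P) : Pos (Form.letter p)
  | cl {A B : Form P} : Pos A → Pos (A ⋏ B)
  | cr {A B : Form P} : Pos B → Pos (A ⋏ B)
  | dl {A B : Form P} : Pos A → Pos (A ⋎ B)
  | dr {A B : Form P} : Pos B → Pos (A ⋎ B)

def Pos.idx {P : Type} : ∀ {A : Form P}, Pos A → ℕ
  | _, .here _ => 0
  | _, .cl x => x.idx
  | _, @Pos.cr _ A _ x => A.size + x.idx
  | _, .dl x => x.idx
  | _, @Pos.dr _ A _ x => A.size + x.idx

def Term.map {P : Type} : ∀ {A B : Form P}, Term P A B → Pos A → Pos B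
  | _, _, .id _, x => x
  | _, _, .comp g f, x => g.map (f.map x)
  | _, _, .conj f _, .cl x => .cl (f.map x)
  | _, _, .conj _ g, .cr x => .cr (g.map x)
  | _, _, .disj f _, .dl x => .dl (f.map x)
  | _, _, .disj _ g, .dr x => .dr (g.map x)
  | _, _, .bConjTo _ _ _, .cl x => .cl (.cl x)
  | _, _, .bConjTo _ _ _, .cr (.cl x) => .cl (.cr x)
  | _, _, .bConjTo _ _ _, .cr (.cr x) => .cr x
  | _, _, .bConjFrom _ _ _, .cl (.cl x) => .cl x
  | _, _, .bConjFrom _ _ _, .cl (.cr x) => .cr (.cl x)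
  | _, _, .bConjFrom _ _ _, .cr x => .cr (.cr x)
  | _, _, .bDisjTo _ _ _, .dl x => .dl (.dl x)
  | _, _, .bDisjTo _ _ _, .dr (.dl x) => .dl (.dr x)
  | _, _, .bDisjTo _ _ _, .dr (.dr x) => .dr x
  | _, _, .bDisjFrom _ _ _, .dl (.dl x) => .dl x
  | _, _, .bDisjFrom _ _ _, .dl (.dr x) => .dr (.dl x)
  | _, _, .bDisjFrom _ _ _, .dr x => .dr (.dr x)
  | _, _, .cConj _ _, .cl x => .cr x
  | _, _, .cConj _ _, .cr x => .cl x
  | _, _, .cDisj _ _, .dl x => .dr x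
  | _, _, .cDisj _ _, .dr x => .dl x
  | _, _, .d _ _ _, .cl x => .dl (.cl x)
  | _, _, .d _ _ _, .cr (.dl x) => .dl (.cr x)
  | _, _, .d _ _ _, .cr (.dr x) => .dr x

theorem Eqv.map_eq {P : Type} {A B : Form P} {f g : Term P A B} (h : Eqv f g) :
    ∀ x, f.map x = g.map x := by
  induction h with
  | refl f => intro x; rfl
  | symm _ ih => intro x; exact (ih x).symm
  | trans _ _ ih1 ih2 => intro x; exact (ih1 x).trans (ih2 x)
  | congComp _ _ ih1 ih2 => intro x; simp only [Term.map, ih1, ih2]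
  | congConj _ _ ih1 ih2 => intro x; cases x <;> simp only [Term.map, ih1, ih2]
  | congDisj _ _ ih1 ih2 => intro x; cases x <;> simp only [Term.map, ih1, ih2]
  | catIdR f => intro x; rfl
  | catIdL f => intro x; rfl
  | catAssoc f g h => intro x; rfl
  | _ =>
    intro x
    rcases x with _ | x | x | x | x <;> first
      | rfl
      | (rcases x with _ | x | x | x | x <;> first
          | rfl
          | (rcases x with _ | x | x | x | x <;> rfl))

theorem Term.map_injective {P : Type} {A B : Form P} (f : Term P A B) :
    Function.Injective f.map := by
  induction f with
  | id A => intro x y h; exact h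
  | comp g f ihg ihf => exact ihg.comp ihf
  | conj f g ihf ihg =>
    intro x y h
    cases x <;> cases y <;> simp only [Term.map, Pos.cl.injEq, Pos.cr.injEq, reduceCtorEq] at h
    · rw [ihf h]
    · rw [ihg h]
  | disj f g ihf ihg =>
    intro x y h
    cases x <;> cases y <;> simp only [Term.map, Pos.dl.injEq, Pos.dr.injEq, reduceCtorEq] at h
    · rw [ihf h]
    · rw [ihg h]
  | bConjTo A B C => exact Function.LeftInverse.injective (fun x => Eqv.map_eq (Eqv.bConjIso₁ A B C) x)
  | bConjFrom A B C => exact Function.LeftInverse.injective (fun x => Eqv.map_eq (Eqv.bConjIso₂ A B C) x)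
  | bDisjTo A B C => exact Function.LeftInverse.injective (fun x => Eqv.map_eq (Eqv.bDisjIso₁ A B C) x)
  | bDisjFrom A B C => exact Function.LeftInverse.injective (fun x => Eqv.map_eq (Eqv.bDisjIso₂ A B C) x)
  | cConj A B => exact Function.LeftInverse.injective (fun x => Eqv.map_eq (Eqv.cConjIso A B) x)
  | cDisj A B => exact Function.LeftInverse.injective (fun x => Eqv.map_eq (Eqv.cDisjIso B A) x)
  | d A B C =>
    intro x y h
    rcases x with _ | x | x <;> rcases y with _ | y | y
    · simp only [Term.map, Pos.dl.injEq, Pos.cl.injEq] at h; rw [h]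
    · cases y <;> simp [Term.map] at h
    · cases x <;> simp [Term.map] at h
    · cases x <;> cases y <;> simp [Term.map] at h <;> rw [h]

theorem Term.map_surjective {P : Type} {A B : Form P} (f : Term P A B) :
    Function.Surjective f.map := by
  induction f with
  | id A => intro x; exact ⟨x, rfl⟩
  | comp g' f' ihg ihf => 
    exact ihg.comp ihf
  | conj f' g' ihf ihg =>
    rintro (_ | y | y)
    · obtain ⟨x, hx⟩ := ihf y; exact ⟨.cl x, by simp only [Term.map, hx]⟩
    · obtain ⟨x, hx⟩ := ihg y; exact ⟨.cr x, by simp only [Term.map, hx]⟩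
  | disj f' g' ihf ihg =>
    intro y
    rcases y with _ | _ | _ | y | y
    · obtain ⟨x, hx⟩ := ihf y; exact ⟨.dl x, by simp only [Term.map, hx]⟩
    · obtain ⟨x, hx⟩ := ihg y; exact ⟨.dr x, by simp only [Term.map, hx]⟩
  | bConjTo A B C => exact Function.RightInverse.surjective (fun x => Eqv.map_eq (Eqv.bConjIso₂ A B C) x)
  | bConjFrom A B C => exact Function.RightInverse.surjective (fun x => Eqv.map_eq (Eqv.bConjIso₁ A B C) x)
  | bDisjTo A B C => exact Function.RightInverse.surjective (fun x => Eqv.map_eq (Eqv.bDisjIso₂ A B C) x)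
  | bDisjFrom A B C => exact Function.RightInverse.surjective (fun x => Eqv.map_eq (Eqv.bDisjIso₁ A B C) x)
  | cConj A B => exact Function.RightInverse.surjective (fun x => Eqv.map_eq (Eqv.cConjIso B A) x)
  | cDisj A B => exact Function.RightInverse.surjective (fun x => Eqv.map_eq (Eqv.cDisjIso A B) x)
  | d A B C =>
    intro y
    cases y with
    | dl y => 
      cases y with
      | cl y => exact ⟨.cl y, rfl⟩
      | cr y => exact ⟨.cr (.dl y), rfl⟩
    | dr y => exact ⟨.cr (.dr y), rfl⟩

theorem Pos.idx_lt {P : Type} {A : Form P} (x : Pos A) : x.idx < A.size := by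
  induction x <;> simp only [Pos.idx, Form.size] <;> omega

theorem Pos.idx_inj {P : Type} {A : Form P} : ∀ {x y : Pos A}, x.idx = y.idx → x = y := by
  intro x
  induction x with
  | here p => intro y _; cases y; rfl
  | cl x ih => 
    intro y h; cases y with
    | cl y => rw [ih h]
    | cr y => have := x.idx_lt; simp only [Pos.idx] at h; omega
  | cr x ih => 
    intro y h; cases y with
    | cl y => have := y.idx_lt; simp only [Pos.idx] at h; omega
    | cr y => simp only [Pos.idx] at h; rw [ih (Nat.add_left_cancel h)]
  | dl x ih => 
    intro y h; cases y with
    | dl y => rw [ih h]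
    | dr y => have := x.idx_lt; simp only [Pos.idx] at h; omega
  | dr x ih => 
    intro y h; cases y with
    | dl y => have := y.idx_lt; simp only [Pos.idx] at h; omega
    | dr y => simp only [Pos.idx] at h; rw [ih (Nat.add_left_cancel h)]

theorem Pos.exists_idx {P : Type} {A : Form P} : ∀ {n : ℕ}, n < A.size → ∃ x : Pos A, x.idx = n := by
  induction A with
  | letter p => intro n h; exact ⟨.here p, by simp only [Form.size] at h; simp only [Pos.idx]; omega⟩
  | conj A B ihA ihB =>
    intro n h
    simp only [Form.size] at h
    by_cases hn : n < A.size
    · obtain ⟨x, hx⟩ := ihA hn; exact ⟨.cl x, hx⟩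
    · obtain ⟨x, hx⟩ := ihB (n := n - A.size) (by omega)
      exact ⟨.cr x, by simp only [Pos.idx]; omega⟩
  | disj A B ihA ihB =>
    intro n h
    simp only [Form.size] at h
    by_cases hn : n < A.size
    · obtain ⟨x, hx⟩ := ihA hn; exact ⟨.dl x, hx⟩
    · obtain ⟨x, hx⟩ := ihB (n := n - A.size) (by omega)
      exact ⟨.dr x, by simp only [Pos.idx]; omega⟩

/-- The split equivalence determined by the action on positions. -/
def Term.R {P : Type} {A B : Form P} (f : Term P A B) : GRel := fun u v =>
  ∃ x : Pos A, (u = Sum.inl x.idx ∨ u = Sum.inr (f.map x).idx) ∧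
    (v = Sum.inl x.idx ∨ v = Sum.inr (f.map x).idx)

theorem R_of_gFun {P : Type} {A B : Form P} (f : Term P A B) (φ : ℕ → ℕ)
    (h : ∀ x, (f.map x).idx = φ x.idx) : gFun A.size φ = f.R := by
  funext u v
  apply propext
  constructor
  · rintro ⟨i, hi, h1, h2⟩
    obtain ⟨x, rfl⟩ := Pos.exists_idx hi
    exact ⟨x, by rw [h]; exact h1, by rw [h]; exact h2⟩
  · rintro ⟨x, h1, h2⟩
    rw [h] at h1 h2
    exact ⟨x.idx, x.idx_lt, h1, h2⟩

theorem R_of_gId {P : Type} {A B : Form P} (f : Term P A B) (n : ℕ) (hn : n = A.size)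
    (h : ∀ x, (f.map x).idx = x.idx) : gId n = f.R := by
  subst hn
  exact R_of_gFun f (fun i => i) h

theorem gPar_R {P : Type} {A B D E : Form P} (f : Term P A D) (g : Term P B E) :
    gPar A.size D.size f.R g.R = fun u v => 
      (∃ x : Pos A, (u = Sum.inl x.idx ∨ u = Sum.inr (f.map x).idx) ∧
        (v = Sum.inl x.idx ∨ v = Sum.inr (f.map x).idx)) ∨
      (∃ x : Pos B, (u = Sum.inl (A.size + x.idx) ∨ u = Sum.inr (D.size + (g.map x).idx)) ∧
        (v = Sum.inl (A.size + x.idx) ∨ v = Sum.inr (D.size + (g.map x).idx))) := by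
  funext u v
  apply propext
  apply or_congr Iff.rfl
  constructor
  · rintro ⟨u', v', ⟨x, h1, h2⟩, rfl, rfl⟩
    refine ⟨x, ?_, ?_⟩
    · rcases h1 with rfl | rfl <;> simp [add_comm]
    · rcases h2 with rfl | rfl <;> simp [add_comm]
  · rintro ⟨x, h1, h2⟩
    have key : ∀ u : ℕ ⊕ ℕ, (u = Sum.inl (A.size + x.idx) ∨ u = Sum.inr (D.size + (g.map x).idx)) →
      ∃ u', (u' = Sum.inl x.idx ∨ u' = Sum.inr (g.map x).idx) ∧ 
        u = Sum.map (· + A.size) (· + D.size) u' := by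
      rintro u (rfl | rfl)
      · exact ⟨_, Or.inl rfl, by simp [add_comm]⟩
      · exact ⟨_, Or.inr rfl, by simp [add_comm]⟩
    obtain ⟨u', hu, hu'⟩ := key u h1
    obtain ⟨v', hv, hv'⟩ := key v h2
    exact ⟨u', v', ⟨x, hu, hv⟩, hu', hv'⟩

theorem gComp_R {P : Type} {A B C : Form P} (g : Term P B C) (f : Term P A B) :
    gComp g.R f.R = (g ⬝ f).R := by
  funext u v
  apply propext
  let N : Pos A → (ℕ ⊕ ℕ ⊕ ℕ) → Prop := fun x a =>
    a = Sum.inl x.idx ∨ a = Sum.inr (Sum.inl (f.map x).idx) ∨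
      a = Sum.inr (Sum.inr (g.map (f.map x)).idx)
  have surj : ∀ y : Pos B, ∃ x : Pos A, f.map x = y := by
    exact f.map_surjective
  have Nuniq : ∀ x y a, N x a → N y a → x = y := by
    rintro x y a (rfl | rfl | rfl) (h | h | h) <;> simp at h
    · exact Pos.idx_inj h
    · exact f.map_injective (Pos.idx_inj h)
    · exact f.map_injective (g.map_injective (Pos.idx_inj h))
  have Nend : ∀ x (w : ℕ ⊕ ℕ), N x (Sum.map id Sum.inr w) ↔
      (w = Sum.inl x.idx ∨ w = Sum.inr ((g ⬝ f).map x).idx) := by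
    intro x w
    cases w <;> simp [N, Term.map]
  have step : ∀ a b, ((∃ x' y', Sum.map id Sum.inl x' = a ∧ Sum.map id Sum.inl y' = b ∧ f.R x' y') ∨
      (∃ x' y', Sum.inr x' = a ∧ Sum.inr y' = b ∧ g.R x' y')) → ∃ x, N x a ∧ N x b := by
    rintro a b (⟨a', b', rfl, rfl, x, h1, h2⟩ | ⟨a', b', rfl, rfl, y, h1, h2⟩)
    · refine ⟨x, ?_, ?_⟩
      · rcases h1 with rfl | rfl <;> simp [N]
      · rcases h2 with rfl | rfl <;> simp [N]
    · obtain ⟨x, rfl⟩ := surj y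
      refine ⟨x, ?_, ?_⟩
      · rcases h1 with rfl | rfl <;> simp [N]
      · rcases h2 with rfl | rfl <;> simp [N]
  constructor
  · intro h
    have main : ∀ a b, Relation.TransGen (fun x y : ℕ ⊕ ℕ ⊕ ℕ =>
      (∃ x' y', Sum.map id Sum.inl x' = x ∧ Sum.map id Sum.inl y' = y ∧ f.R x' y') ∨
      (∃ x' y', Sum.inr x' = x ∧ Sum.inr y' = y ∧ g.R x' y')) a b → ∃ x, N x a ∧ N x b := by
      intro a b hab
      induction hab with
      | single h => exact step _ _ h
      | tail _ h ih =>
        obtain ⟨x, hx1, hx2⟩ := ih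
        obtain ⟨y, hy1, hy2⟩ := step _ _ h
        obtain rfl := Nuniq _ _ _ hx2 hy1
        exact ⟨x, hx1, hy2⟩
    obtain ⟨x, h1, h2⟩ := main _ _ h
    exact ⟨x, (Nend x u).1 h1, (Nend x v).1 h2⟩
  · rintro ⟨x, h1, h2⟩
    refine Relation.TransGen.trans (b := Sum.inr (Sum.inl (f.map x).idx)) ?_ ?_
    · apply Relation.TransGen.single
      rcases h1 with rfl | rfl
      · exact Or.inl ⟨Sum.inl x.idx, Sum.inr (f.map x).idx, rfl, rfl, x, Or.inl rfl, Or.inr rfl⟩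
      · exact Or.inr ⟨Sum.inr _, Sum.inl (f.map x).idx, rfl, rfl, f.map x, Or.inr rfl, Or.inl rfl⟩
    · apply Relation.TransGen.single
      rcases h2 with rfl | rfl
      · exact Or.inl ⟨Sum.inr (f.map x).idx, Sum.inl x.idx, rfl, rfl, x, Or.inr rfl, Or.inl rfl⟩
      · exact Or.inr ⟨Sum.inl (f.map x).idx, Sum.inr _, rfl, rfl, f.map x, Or.inl rfl, Or.inr rfl⟩

theorem G_eq_R {P : Type} {A B : Form P} (f : Term P A B) : f.G = f.R := by
  induction f with
  | id A => exact R_of_gId _ _ rfl (fun x => rfl)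
  | comp g f ihg ihf => rw [Term.G, ihg, ihf, gComp_R]
  | conj f g ihf ihg =>
    rw [Term.G, ihf, ihg, gPar_R]
    funext u v
    apply propext
    constructor
    · rintro (⟨x, h1, h2⟩ | ⟨x, h1, h2⟩)
      · exact ⟨.cl x, h1, h2⟩
      · exact ⟨.cr x, h1, h2⟩
    · rintro ⟨_ | x | x, h1, h2⟩
      · exact Or.inl ⟨x, h1, h2⟩
      · exact Or.inr ⟨x, h1, h2⟩
  | disj f g ihf ihg =>
    rw [Term.G, ihf, ihg, gPar_R]
    funext u v
    apply propext
    constructor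
    · rintro (⟨x, h1, h2⟩ | ⟨x, h1, h2⟩)
      · exact ⟨.dl x, h1, h2⟩
      · exact ⟨.dr x, h1, h2⟩
    · rintro ⟨x, h1, h2⟩
      cases x with
      | dl x => exact Or.inl ⟨x, h1, h2⟩
      | dr x => exact Or.inr ⟨x, h1, h2⟩
  | bConjTo A B C =>
    refine R_of_gId _ _ rfl (fun x => ?_)
    cases x with
    | cl x => rfl
    | cr x => cases x <;> simp only [Term.map, Pos.idx, Form.size] <;> omega
  | bConjFrom A B C =>
    refine R_of_gId _ _ rfl (fun x => ?_)
    cases x with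
    | cl x => cases x <;> simp only [Term.map, Pos.idx, Form.size]
    | cr x => simp only [Term.map, Pos.idx, Form.size]; omega
  | bDisjTo A B C =>
    refine R_of_gId _ _ rfl (fun x => ?_)
    cases x with
    | dl x => rfl
    | dr x => cases x <;> simp only [Term.map, Pos.idx, Form.size] <;> omega
  | bDisjFrom A B C =>
    refine R_of_gId _ _ rfl (fun x => ?_)
    cases x with
    | dl x => cases x <;> simp only [Term.map, Pos.idx, Form.size]
    | dr x => simp only [Term.map, Pos.idx, Form.size]; omega
  | cConj A B =>
    refine R_of_gFun (Term.cConj A B) _ (fun x => ?_)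
    cases x with
    | cl x =>
      have := x.idx_lt
      exact (add_comm _ _).trans (if_pos (c := x.idx < A.size) this).symm
    | cr x =>
      refine Eq.trans ?_ (if_neg (c := A.size + x.idx < A.size) (by omega)).symm
      exact (Nat.add_sub_cancel_left _ _).symm
  | cDisj A B =>
    refine R_of_gFun (Term.cDisj A B) _ (fun x => ?_)
    cases x with
    | dl x =>
      have := x.idx_lt
      exact (add_comm _ _).trans (if_pos (c := x.idx < B.size) this).symm
    | dr x =>
      refine Eq.trans ?_ (if_neg (c := B.size + x.idx < B.size) (by omega)).symm
      exact (Nat.add_sub_cancel_left _ _).symm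
  | d A B C =>
    refine R_of_gId _ _ rfl (fun x => ?_)
    cases x with
    | cl x => rfl
    | cr x => cases x <;> simp only [Term.map, Pos.idx, Form.size] <;> omega

theorem linked_iff {P : Type} {A B : Form P} (f : Term P A B) (n m : ℕ) :
    Linked f n m ↔ ∃ x : Pos A, x.idx = n ∧ (f.map x).idx = m := by
  unfold Linked
  rw [G_eq_R]
  constructor
  · rintro ⟨x, h1 | h1, h2 | h2⟩ <;> simp at h1 h2
    exact ⟨x, h1.symm, h2.symm⟩
  · rintro ⟨x, rfl, rfl⟩
    exact ⟨x, Or.inl rfl, Or.inr rfl⟩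


/-! ### The category DS -/

open CategoryTheory

def dsSetoid {P : Type} (A B : Form P) : Setoid (Term P A B) where
  r f g := Eqv f g
  iseqv := ⟨Eqv.refl, Eqv.symm, Eqv.trans⟩

instance dsCat {P : Type} : Category (Form P) where
  Hom A B := Quotient (dsSetoid A B)
  id A := Quotient.mk _ (Term.id A)
  comp f g := Quotient.map₂ (fun f g => Term.comp g f) (fun _ _ h1 _ _ h2 => Eqv.congComp h2 h1) f g
  id_comp f := by
    induction f using Quotient.inductionOn
    exact Quotient.sound (Eqv.catIdR _)
  comp_id f := by
    induction f using Quotient.inductionOn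
    exact Quotient.sound (Eqv.catIdL _)
  assoc f g h := by
    induction f using Quotient.inductionOn
    induction g using Quotient.inductionOn
    induction h using Quotient.inductionOn
    exact Quotient.sound (Eqv.catAssoc _ _ _)

section DS

variable {P : Type}

/-- The arrow of DS given by an arrow term. -/
def Term.cls {A B : Form P} (f : Term P A B) : A ⟶ B := Quotient.mk (dsSetoid A B) f

theorem Term.cls_eq {A B : Form P} {f g : Term P A B} : f.cls = g.cls ↔ Eqv f g :=
  ⟨fun h => Quotient.exact h, fun h => Quotient.sound h⟩

theorem exists_cls {A B : Form P} (f : A ⟶ B) : ∃ t : Term P A B, t.cls = f :=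
  Quotient.exists_rep f

def cj {A B D E : Form P} (f : A ⟶ D) (g : B ⟶ E) : (A ⋏ B) ⟶ (D ⋏ E) :=
  Quotient.map₂ (fun f g => Term.conj f g) (fun _ _ h1 _ _ h2 => Eqv.congConj h1 h2) f g

def dj {A B D E : Form P} (f : A ⟶ D) (g : B ⟶ E) : (A ⋎ B) ⟶ (D ⋎ E) :=
  Quotient.map₂ (fun f g => Term.disj f g) (fun _ _ h1 _ _ h2 => Eqv.congDisj h1 h2) f g

def ca (A B : Form P) : (A ⋏ B) ⟶ (B ⋏ A) := (Term.cConj A B).cls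
def co (A B : Form P) : (A ⋎ B) ⟶ (B ⋎ A) := (Term.cDisj B A).cls
def aa (A B C : Form P) : (A ⋏ (B ⋏ C)) ⟶ ((A ⋏ B) ⋏ C) := (Term.bConjTo A B C).cls
def aa' (A B C : Form P) : ((A ⋏ B) ⋏ C) ⟶ (A ⋏ (B ⋏ C)) := (Term.bConjFrom A B C).cls
def ao (A B C : Form P) : (A ⋎ (B ⋎ C)) ⟶ ((A ⋎ B) ⋎ C) := (Term.bDisjTo A B C).cls
def ao' (A B C : Form P) : ((A ⋎ B) ⋎ C) ⟶ (A ⋎ (B ⋎ C)) := (Term.bDisjFrom A B C).cls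
def dd (A B C : Form P) : (A ⋏ (B ⋎ C)) ⟶ ((A ⋏ B) ⋎ C) := (Term.d A B C).cls

theorem cls_comp {A B C : Form P} (g : Term P B C) (f : Term P A B) :
    (g ⬝ f).cls = f.cls ≫ g.cls := rfl
theorem cls_id (A : Form P) : (Term.id A).cls = 𝟙 A := rfl
theorem cls_conj {A B D E : Form P} (f : Term P A D) (g : Term P B E) :
    (f ⊼ g).cls = cj f.cls g.cls := rfl
theorem cls_disj {A B D E : Form P} (f : Term P A D) (g : Term P B E) :
    (f ⊽ g).cls = dj f.cls g.cls := rfl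

@[simp] theorem cj_id (A B : Form P) : cj (𝟙 A) (𝟙 B) = 𝟙 (A ⋏ B) :=
  Quotient.sound (Eqv.conjOne A B)
@[simp] theorem dj_id (A B : Form P) : dj (𝟙 A) (𝟙 B) = 𝟙 (A ⋎ B) :=
  Quotient.sound (Eqv.disjOne A B)

theorem cj_cj {A B C A' B' C' : Form P} (f : A ⟶ B) (g : B ⟶ C) (f' : A' ⟶ B') (g' : B' ⟶ C') :
    cj f f' ≫ cj g g' = cj (f ≫ g) (f' ≫ g') := by
  induction f using Quotient.inductionOn
  induction g using Quotient.inductionOn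
  induction f' using Quotient.inductionOn
  induction g' using Quotient.inductionOn
  exact Quotient.sound (Eqv.conjTwo _ _ _ _).symm

theorem dj_dj {A B C A' B' C' : Form P} (f : A ⟶ B) (g : B ⟶ C) (f' : A' ⟶ B') (g' : B' ⟶ C') :
    dj f f' ≫ dj g g' = dj (f ≫ g) (f' ≫ g') := by
  induction f using Quotient.inductionOn
  induction g using Quotient.inductionOn
  induction f' using Quotient.inductionOn
  induction g' using Quotient.inductionOn
  exact Quotient.sound (Eqv.disjTwo _ _ _ _).symm

theorem aa_nat {A B C D E F : Form P} (f : A ⟶ D) (g : B ⟶ E) (h : C ⟶ F) :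
    aa A B C ≫ cj (cj f g) h = cj f (cj g h) ≫ aa D E F := by
  induction f using Quotient.inductionOn
  induction g using Quotient.inductionOn
  induction h using Quotient.inductionOn
  exact Quotient.sound (Eqv.bConjNat _ _ _)

theorem ao_nat {A B C D E F : Form P} (f : A ⟶ D) (g : B ⟶ E) (h : C ⟶ F) :
    ao A B C ≫ dj (dj f g) h = dj f (dj g h) ≫ ao D E F := by
  induction f using Quotient.inductionOn
  induction g using Quotient.inductionOn
  induction h using Quotient.inductionOn
  exact Quotient.sound (Eqv.bDisjNat _ _ _)

theorem ca_nat {A B D E : Form P} (f : A ⟶ D) (g : B ⟶ E) :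
    ca A B ≫ cj g f = cj f g ≫ ca D E := by
  induction f using Quotient.inductionOn
  induction g using Quotient.inductionOn
  exact Quotient.sound (Eqv.cConjNat _ _)

theorem co_nat {A B D E : Form P} (f : A ⟶ D) (g : B ⟶ E) :
    co A B ≫ dj g f = dj f g ≫ co D E := by
  induction f using Quotient.inductionOn
  induction g using Quotient.inductionOn
  exact Quotient.sound (Eqv.cDisjNat _ _)

theorem dd_nat {A B C D E F : Form P} (f : A ⟶ D) (g : B ⟶ E) (h : C ⟶ F) :
    dd A B C ≫ dj (cj f g) h = cj f (dj g h) ≫ dd D E F := by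
  induction f using Quotient.inductionOn
  induction g using Quotient.inductionOn
  induction h using Quotient.inductionOn
  exact Quotient.sound (Eqv.dNat _ _ _)

@[simp] theorem aa_aa' (A B C : Form P) : aa A B C ≫ aa' A B C = 𝟙 _ :=
  Quotient.sound (Eqv.bConjIso₁ A B C)
@[simp] theorem aa'_aa (A B C : Form P) : aa' A B C ≫ aa A B C = 𝟙 _ :=
  Quotient.sound (Eqv.bConjIso₂ A B C)
@[simp] theorem ao_ao' (A B C : Form P) : ao A B C ≫ ao' A B C = 𝟙 _ :=
  Quotient.sound (Eqv.bDisjIso₁ A B C)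
@[simp] theorem ao'_ao (A B C : Form P) : ao' A B C ≫ ao A B C = 𝟙 _ :=
  Quotient.sound (Eqv.bDisjIso₂ A B C)
@[simp] theorem ca_ca (A B : Form P) : ca A B ≫ ca B A = 𝟙 _ :=
  Quotient.sound (Eqv.cConjIso A B)
@[simp] theorem co_co (A B : Form P) : co A B ≫ co B A = 𝟙 _ :=
  Quotient.sound (Eqv.cDisjIso A B)

@[simp] theorem aa_aa'_assoc (A B C : Form P) {X : Form P} (h : _ ⟶ X) :
    aa A B C ≫ aa' A B C ≫ h = h := by rw [← Category.assoc, aa_aa', Category.id_comp]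
@[simp] theorem aa'_aa_assoc (A B C : Form P) {X : Form P} (h : _ ⟶ X) :
    aa' A B C ≫ aa A B C ≫ h = h := by rw [← Category.assoc, aa'_aa, Category.id_comp]
@[simp] theorem ao_ao'_assoc (A B C : Form P) {X : Form P} (h : _ ⟶ X) :
    ao A B C ≫ ao' A B C ≫ h = h := by rw [← Category.assoc, ao_ao', Category.id_comp]
@[simp] theorem ao'_ao_assoc (A B C : Form P) {X : Form P} (h : _ ⟶ X) :
    ao' A B C ≫ ao A B C ≫ h = h := by rw [← Category.assoc, ao'_ao, Category.id_comp]
@[simp] theorem ca_ca_assoc (A B : Form P) {X : Form P} (h : _ ⟶ X) :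
    ca A B ≫ ca B A ≫ h = h := by rw [← Category.assoc, ca_ca, Category.id_comp]
@[simp] theorem co_co_assoc (A B : Form P) {X : Form P} (h : _ ⟶ X) :
    co A B ≫ co B A ≫ h = h := by rw [← Category.assoc, co_co, Category.id_comp]

theorem aa'_nat {A B C D E F : Form P} (f : A ⟶ D) (g : B ⟶ E) (h : C ⟶ F) :
    aa' A B C ≫ cj f (cj g h) = cj (cj f g) h ≫ aa' D E F := by
  have := aa_nat f g h
  calc aa' A B C ≫ cj f (cj g h) = aa' A B C ≫ (cj f (cj g h) ≫ aa D E F) ≫ aa' D E F := by simp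
    _ = _ := by rw [← this]; simp

theorem ao'_nat {A B C D E F : Form P} (f : A ⟶ D) (g : B ⟶ E) (h : C ⟶ F) :
    ao' A B C ≫ dj f (dj g h) = dj (dj f g) h ≫ ao' D E F := by
  have := ao_nat f g h
  calc ao' A B C ≫ dj f (dj g h) = ao' A B C ≫ (dj f (dj g h) ≫ ao D E F) ≫ ao' D E F := by simp
    _ = _ := by rw [← this]; simp

theorem pentA (A B C D : Form P) : aa' (A ⋏ B) C D ≫ aa' A B (C ⋏ D) =
    cj (aa' A B C) (𝟙 D) ≫ aa' A (B ⋏ C) D ≫ cj (𝟙 A) (aa' B C D) := by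
  rw [← Category.assoc]
  exact Quotient.sound (Eqv.bConjPent A B C D)
theorem pentO (A B C D : Form P) : ao' (A ⋎ B) C D ≫ ao' A B (C ⋎ D) =
    dj (ao' A B C) (𝟙 D) ≫ ao' A (B ⋎ C) D ≫ dj (𝟙 A) (ao' B C D) := by
  rw [← Category.assoc]
  exact Quotient.sound (Eqv.bDisjPent A B C D)
theorem hexA (A B C : Form P) : cj (ca B A) (𝟙 C) ≫ aa' A B C ≫ ca A (B ⋏ C) ≫ aa' B C A ≫
    cj (𝟙 B) (ca C A) = aa' B A C := by
  have := Term.cls_eq.2 (Eqv.bcConj A B C)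
  simp only [cls_comp, cls_disj, cls_conj, cls_id, Category.assoc] at this
  exact this
theorem hexO (A B C : Form P) : dj (co B A) (𝟙 C) ≫ ao' A B C ≫ co A (B ⋎ C) ≫ ao' B C A ≫
    dj (𝟙 B) (co C A) = ao' B A C := by
  have := Term.cls_eq.2 (Eqv.bcDisj A B C)
  simp only [cls_comp, cls_disj, cls_conj, cls_id, Category.assoc] at this
  exact this
theorem dConj' (A B C D : Form P) : dd (A ⋏ B) C D ≫ dj (aa' A B C) (𝟙 D) =
    aa' A B (C ⋎ D) ≫ cj (𝟙 A) (dd B C D) ≫ dd A (B ⋏ C) D := by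
  have := Term.cls_eq.2 (Eqv.dConj A B C D)
  simp only [cls_comp, cls_disj, cls_conj, cls_id, Category.assoc] at this
  exact this
theorem dDisj' (D C B A : Form P) : cj (𝟙 D) (ao' C B A) ≫ dd D C (B ⋎ A) =
    dd D (C ⋎ B) A ≫ dj (dd D C B) (𝟙 A) ≫ ao' (D ⋏ C) B A := by
  have := Term.cls_eq.2 (Eqv.dDisj D C B A)
  simp only [cls_comp, cls_disj, cls_conj, cls_id, Category.assoc] at this
  exact this

def ddR (C B A : Form P) : ((C ⋎ B) ⋏ A) ⟶ (C ⋎ (B ⋏ A)) := (dR C B A).cls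
theorem ddR_eq (C B A : Form P) : ddR C B A = ca (C ⋎ B) A ≫ cj (𝟙 A) (co C B) ≫ dd A B C ≫
    dj (ca A B) (𝟙 C) ≫ co (B ⋏ A) C := by
  unfold ddR dR
  simp only [cls_comp, cls_disj, cls_conj, cls_id, Category.assoc]
  rfl
theorem dBConj' (A B C D : Form P) : cj (dd A B C) (𝟙 D) ≫ ddR (A ⋏ B) C D =
    aa' A (B ⋎ C) D ≫ cj (𝟙 A) (ddR B C D) ≫ dd A B (C ⋏ D) := by
  have := Term.cls_eq.2 (Eqv.dBConj A B C D)
  simp only [cls_comp, cls_disj, cls_conj, cls_id, Category.assoc] at this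
  exact this
theorem dBDisj' (D C B A : Form P) : ddR D C (B ⋎ A) ≫ dj (𝟙 D) (dd C B A) =
    dd (D ⋎ C) B A ≫ dj (ddR D C B) (𝟙 A) ≫ ao' D (C ⋏ B) A := by
  have := Term.cls_eq.2 (Eqv.dBDisj D C B A)
  simp only [cls_comp, cls_disj, cls_conj, cls_id, Category.assoc] at this
  exact this

end DS

open CategoryTheory
section DS2
variable {P : Type}

theorem dj_comp_right (X : Form P) {A B C : Form P} (f : A ⟶ B) (g : B ⟶ C) :
    dj (𝟙 X) (f ≫ g) = dj (𝟙 X) f ≫ dj (𝟙 X) g := by rw [dj_dj, Category.comp_id]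
theorem dj_comp_left (X : Form P) {A B C : Form P} (f : A ⟶ B) (g : B ⟶ C) :
    dj (f ≫ g) (𝟙 X) = dj f (𝟙 X) ≫ dj g (𝟙 X) := by rw [dj_dj, Category.comp_id]
theorem dj_split {A B C D : Form P} (f : A ⟶ B) (g : C ⟶ D) :
    dj f g = dj f (𝟙 C) ≫ dj (𝟙 B) g := by rw [dj_dj, Category.comp_id, Category.id_comp]
theorem dj_split' {A B C D : Form P} (f : A ⟶ B) (g : C ⟶ D) :
    dj f g = dj (𝟙 A) g ≫ dj f (𝟙 D) := by rw [dj_dj, Category.comp_id, Category.id_comp]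
@[simp] theorem dj_co_co_right (X A B : Form P) : dj (𝟙 X) (co A B) ≫ dj (𝟙 X) (co B A) = 𝟙 _ := by
  rw [← dj_comp_right]; simp
@[simp] theorem dj_co_co_left (X A B : Form P) : dj (co A B) (𝟙 X) ≫ dj (co B A) (𝟙 X) = 𝟙 _ := by
  rw [← dj_comp_left]; simp
@[simp] theorem dj_co_co_right_assoc (X A B : Form P) {Z : Form P} (h : _ ⟶ Z) :
    dj (𝟙 X) (co A B) ≫ dj (𝟙 X) (co B A) ≫ h = h := by
  rw [← Category.assoc, dj_co_co_right, Category.id_comp]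
@[simp] theorem dj_co_co_left_assoc (X A B : Form P) {Z : Form P} (h : _ ⟶ Z) :
    dj (co A B) (𝟙 X) ≫ dj (co B A) (𝟙 X) ≫ h = h := by
  rw [← Category.assoc, dj_co_co_left, Category.id_comp]
@[simp] theorem dj_ao_ao'_right (X A B C : Form P) :
    dj (𝟙 X) (ao A B C) ≫ dj (𝟙 X) (ao' A B C) = 𝟙 _ := by
  rw [← dj_comp_right]; simp
@[simp] theorem dj_ao_ao'_left (X A B C : Form P) :
    dj (ao A B C) (𝟙 X) ≫ dj (ao' A B C) (𝟙 X) = 𝟙 _ := by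
  rw [← dj_comp_left]; simp
@[simp] theorem dj_ao_ao'_right_assoc (X A B C : Form P) {Z : Form P} (h : _ ⟶ Z) :
    dj (𝟙 X) (ao A B C) ≫ dj (𝟙 X) (ao' A B C) ≫ h = h := by
  rw [← Category.assoc, dj_ao_ao'_right, Category.id_comp]
@[simp] theorem dj_ao_ao'_left_assoc (X A B C : Form P) {Z : Form P} (h : _ ⟶ Z) :
    dj (ao A B C) (𝟙 X) ≫ dj (ao' A B C) (𝟙 X) ≫ h = h := by
  rw [← Category.assoc, dj_ao_ao'_left, Category.id_comp]
@[simp] theorem dj_ao'_ao_right (X A B C : Form P) :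
    dj (𝟙 X) (ao' A B C) ≫ dj (𝟙 X) (ao A B C) = 𝟙 _ := by
  rw [← dj_comp_right]; simp
@[simp] theorem dj_ao'_ao_left (X A B C : Form P) :
    dj (ao' A B C) (𝟙 X) ≫ dj (ao A B C) (𝟙 X) = 𝟙 _ := by
  rw [← dj_comp_left]; simp
@[simp] theorem dj_ao'_ao_right_assoc (X A B C : Form P) {Z : Form P} (h : _ ⟶ Z) :
    dj (𝟙 X) (ao' A B C) ≫ dj (𝟙 X) (ao A B C) ≫ h = h := by
  rw [← Category.assoc, dj_ao'_ao_right, Category.id_comp]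
@[simp] theorem dj_ao'_ao_left_assoc (X A B C : Form P) {Z : Form P} (h : _ ⟶ Z) :
    dj (ao' A B C) (𝟙 X) ≫ dj (ao A B C) (𝟙 X) ≫ h = h := by
  rw [← Category.assoc, dj_ao'_ao_left, Category.id_comp]
theorem ao_nat_assoc {A B C D E F : Form P} (f : A ⟶ D) (g : B ⟶ E) (h : C ⟶ F) {X : Form P}
    (k : _ ⟶ X) : ao A B C ≫ dj (dj f g) h ≫ k = dj f (dj g h) ≫ ao D E F ≫ k := by
  rw [← Category.assoc, ao_nat, Category.assoc]
theorem ao'_nat_assoc {A B C D E F : Form P} (f : A ⟶ D) (g : B ⟶ E) (h : C ⟶ F) {X : Form P}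
    (k : _ ⟶ X) : ao' A B C ≫ dj f (dj g h) ≫ k = dj (dj f g) h ≫ ao' D E F ≫ k := by
  rw [← Category.assoc, ao'_nat, Category.assoc]
theorem co_nat_assoc {A B D E : Form P} (f : A ⟶ D) (g : B ⟶ E) {X : Form P}
    (k : _ ⟶ X) : co A B ≫ dj g f ≫ k = dj f g ≫ co D E ≫ k := by
  rw [← Category.assoc, co_nat, Category.assoc]

def sig (E V x : Form P) : (E ⋎ (V ⋎ x)) ⟶ (V ⋎ (E ⋎ x)) :=
  ao E V x ≫ dj (co E V) (𝟙 x) ≫ ao' V E x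

theorem sig_alt (A B C : Form P) :
    sig A B C = co A (B ⋎ C) ≫ ao' B C A ≫ dj (𝟙 B) (co C A) := by
  unfold sig; rw [← hexO]; simp

@[simp] theorem sig_sig (A B C : Form P) : sig A B C ≫ sig B A C = 𝟙 _ := by
  simp [sig]

theorem sig_alt2 (A B C : Form P) :
    dj (𝟙 A) (co B C) ≫ ao A C B ≫ co (A ⋎ C) B = sig A B C := by
  have h : (dj (𝟙 A) (co B C) ≫ ao A C B ≫ co (A ⋎ C) B) ≫ sig B A C = 𝟙 _ := by
    rw [sig_alt]; simp
  calc _ = ((dj (𝟙 A) (co B C) ≫ ao A C B ≫ co (A ⋎ C) B) ≫ sig B A C) ≫ sig A B C := by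
        rw [Category.assoc, sig_sig, Category.comp_id]
    _ = _ := by rw [h, Category.id_comp]

theorem sig_nat {A B C D E F : Form P} (f : A ⟶ D) (g : B ⟶ E) (h : C ⟶ F) :
    sig A B C ≫ dj g (dj f h) = dj f (dj g h) ≫ sig D E F := by
  unfold sig
  simp only [Category.assoc]
  rw [ao'_nat, ← ao_nat_assoc]
  congr 1
  rw [← Category.assoc, ← Category.assoc, dj_dj, dj_dj, co_nat, Category.id_comp, Category.comp_id]

theorem ao_rev (A B C : Form P) : ao A B C = co A (B ⋎ C) ≫ dj (co B C) (𝟙 A) ≫ ao' C B A ≫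
    dj (𝟙 C) (co B A) ≫ co C (A ⋎ B) := by
  have h1 : ao A B C = sig A B C ≫ ao B A C ≫ dj (co B A) (𝟙 C) := by simp [sig]
  have h2 : dj (𝟙 B) (co C A) ≫ ao B A C = sig B C A ≫ co C (B ⋎ A) := by
    rw [← sig_alt2]; simp
  have h3 : ao' B C A ≫ sig B C A = dj (co B C) (𝟙 A) ≫ ao' C B A := by simp [sig]
  rw [h1, sig_alt]
  simp only [Category.assoc]
  rw [reassoc_of% h2, reassoc_of% h3, co_nat]

theorem ao_rev' (A B C : Form P) : ao' A B C = co (A ⋎ B) C ≫ dj (𝟙 C) (co A B) ≫ ao C B A ≫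
    dj (co C B) (𝟙 A) ≫ co (B ⋎ C) A := by
  have h : ao A B C ≫ (co (A ⋎ B) C ≫ dj (𝟙 C) (co A B) ≫ ao C B A ≫
    dj (co C B) (𝟙 A) ≫ co (B ⋎ C) A) = 𝟙 _ := by rw [ao_rev]; simp
  calc _ = ao' A B C ≫ ao A B C ≫ (co (A ⋎ B) C ≫ dj (𝟙 C) (co A B) ≫ ao C B A ≫
    dj (co C B) (𝟙 A) ≫ co (B ⋎ C) A) := by rw [h]; simp
    _ = _ := by simp

theorem cj_comp_right (X : Form P) {A B C : Form P} (f : A ⟶ B) (g : B ⟶ C) :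
    cj (𝟙 X) (f ≫ g) = cj (𝟙 X) f ≫ cj (𝟙 X) g := by rw [cj_cj, Category.comp_id]
theorem cj_comp_left (X : Form P) {A B C : Form P} (f : A ⟶ B) (g : B ⟶ C) :
    cj (f ≫ g) (𝟙 X) = cj f (𝟙 X) ≫ cj g (𝟙 X) := by rw [cj_cj, Category.comp_id]
theorem cj_split {A B C D : Form P} (f : A ⟶ B) (g : C ⟶ D) :
    cj f g = cj f (𝟙 C) ≫ cj (𝟙 B) g := by rw [cj_cj, Category.comp_id, Category.id_comp]
theorem cj_split' {A B C D : Form P} (f : A ⟶ B) (g : C ⟶ D) :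
    cj f g = cj (𝟙 A) g ≫ cj f (𝟙 D) := by rw [cj_cj, Category.comp_id, Category.id_comp]
@[simp] theorem cj_ca_ca_right (X A B : Form P) : cj (𝟙 X) (ca A B) ≫ cj (𝟙 X) (ca B A) = 𝟙 _ := by
  rw [← cj_comp_right]; simp
@[simp] theorem cj_ca_ca_left (X A B : Form P) : cj (ca A B) (𝟙 X) ≫ cj (ca B A) (𝟙 X) = 𝟙 _ := by
  rw [← cj_comp_left]; simp
@[simp] theorem cj_ca_ca_right_assoc (X A B : Form P) {Z : Form P} (h : _ ⟶ Z) :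
    cj (𝟙 X) (ca A B) ≫ cj (𝟙 X) (ca B A) ≫ h = h := by
  rw [← Category.assoc, cj_ca_ca_right, Category.id_comp]
@[simp] theorem cj_ca_ca_left_assoc (X A B : Form P) {Z : Form P} (h : _ ⟶ Z) :
    cj (ca A B) (𝟙 X) ≫ cj (ca B A) (𝟙 X) ≫ h = h := by
  rw [← Category.assoc, cj_ca_ca_left, Category.id_comp]
@[simp] theorem cj_aa_aa'_right (X A B C : Form P) :
    cj (𝟙 X) (aa A B C) ≫ cj (𝟙 X) (aa' A B C) = 𝟙 _ := by
  rw [← cj_comp_right]; simp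
@[simp] theorem cj_aa_aa'_left (X A B C : Form P) :
    cj (aa A B C) (𝟙 X) ≫ cj (aa' A B C) (𝟙 X) = 𝟙 _ := by
  rw [← cj_comp_left]; simp
@[simp] theorem cj_aa_aa'_right_assoc (X A B C : Form P) {Z : Form P} (h : _ ⟶ Z) :
    cj (𝟙 X) (aa A B C) ≫ cj (𝟙 X) (aa' A B C) ≫ h = h := by
  rw [← Category.assoc, cj_aa_aa'_right, Category.id_comp]
@[simp] theorem cj_aa_aa'_left_assoc (X A B C : Form P) {Z : Form P} (h : _ ⟶ Z) :
    cj (aa A B C) (𝟙 X) ≫ cj (aa' A B C) (𝟙 X) ≫ h = h := by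
  rw [← Category.assoc, cj_aa_aa'_left, Category.id_comp]
@[simp] theorem cj_aa'_aa_right (X A B C : Form P) :
    cj (𝟙 X) (aa' A B C) ≫ cj (𝟙 X) (aa A B C) = 𝟙 _ := by
  rw [← cj_comp_right]; simp
@[simp] theorem cj_aa'_aa_left (X A B C : Form P) :
    cj (aa' A B C) (𝟙 X) ≫ cj (aa A B C) (𝟙 X) = 𝟙 _ := by
  rw [← cj_comp_left]; simp
@[simp] theorem cj_aa'_aa_right_assoc (X A B C : Form P) {Z : Form P} (h : _ ⟶ Z) :
    cj (𝟙 X) (aa' A B C) ≫ cj (𝟙 X) (aa A B C) ≫ h = h := by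
  rw [← Category.assoc, cj_aa'_aa_right, Category.id_comp]
@[simp] theorem cj_aa'_aa_left_assoc (X A B C : Form P) {Z : Form P} (h : _ ⟶ Z) :
    cj (aa' A B C) (𝟙 X) ≫ cj (aa A B C) (𝟙 X) ≫ h = h := by
  rw [← Category.assoc, cj_aa'_aa_left, Category.id_comp]
theorem aa_nat_assoc {A B C D E F : Form P} (f : A ⟶ D) (g : B ⟶ E) (h : C ⟶ F) {X : Form P}
    (k : _ ⟶ X) : aa A B C ≫ cj (cj f g) h ≫ k = cj f (cj g h) ≫ aa D E F ≫ k := by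
  rw [← Category.assoc, aa_nat, Category.assoc]
theorem aa'_nat_assoc {A B C D E F : Form P} (f : A ⟶ D) (g : B ⟶ E) (h : C ⟶ F) {X : Form P}
    (k : _ ⟶ X) : aa' A B C ≫ cj f (cj g h) ≫ k = cj (cj f g) h ≫ aa' D E F ≫ k := by
  rw [← Category.assoc, aa'_nat, Category.assoc]
theorem ca_nat_assoc {A B D E : Form P} (f : A ⟶ D) (g : B ⟶ E) {X : Form P}
    (k : _ ⟶ X) : ca A B ≫ cj g f ≫ k = cj f g ≫ ca D E ≫ k := by
  rw [← Category.assoc, ca_nat, Category.assoc]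

def tau (E V x : Form P) : (E ⋏ (V ⋏ x)) ⟶ (V ⋏ (E ⋏ x)) :=
  aa E V x ≫ cj (ca E V) (𝟙 x) ≫ aa' V E x

theorem tau_alt (A B C : Form P) :
    tau A B C = ca A (B ⋏ C) ≫ aa' B C A ≫ cj (𝟙 B) (ca C A) := by
  unfold tau; rw [← hexA]; simp

@[simp] theorem tau_tau (A B C : Form P) : tau A B C ≫ tau B A C = 𝟙 _ := by
  simp [tau]

theorem tau_alt2 (A B C : Form P) :
    cj (𝟙 A) (ca B C) ≫ aa A C B ≫ ca (A ⋏ C) B = tau A B C := by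
  have h : (cj (𝟙 A) (ca B C) ≫ aa A C B ≫ ca (A ⋏ C) B) ≫ tau B A C = 𝟙 _ := by
    rw [tau_alt]; simp
  calc _ = ((cj (𝟙 A) (ca B C) ≫ aa A C B ≫ ca (A ⋏ C) B) ≫ tau B A C) ≫ tau A B C := by
        rw [Category.assoc, tau_tau, Category.comp_id]
    _ = _ := by rw [h, Category.id_comp]

theorem tau_nat {A B C D E F : Form P} (f : A ⟶ D) (g : B ⟶ E) (h : C ⟶ F) :
    tau A B C ≫ cj g (cj f h) = cj f (cj g h) ≫ tau D E F := by
  unfold tau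
  simp only [Category.assoc]
  rw [aa'_nat, ← aa_nat_assoc]
  congr 1
  rw [← Category.assoc, ← Category.assoc, cj_cj, cj_cj, ca_nat, Category.id_comp, Category.comp_id]

theorem aa_rev (A B C : Form P) : aa A B C = ca A (B ⋏ C) ≫ cj (ca B C) (𝟙 A) ≫ aa' C B A ≫
    cj (𝟙 C) (ca B A) ≫ ca C (A ⋏ B) := by
  have h1 : aa A B C = tau A B C ≫ aa B A C ≫ cj (ca B A) (𝟙 C) := by simp [tau]
  have h2 : cj (𝟙 B) (ca C A) ≫ aa B A C = tau B C A ≫ ca C (B ⋏ A) := by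
    rw [← tau_alt2]; simp
  have h3 : aa' B C A ≫ tau B C A = cj (ca B C) (𝟙 A) ≫ aa' C B A := by simp [tau]
  rw [h1, tau_alt]
  simp only [Category.assoc]
  rw [reassoc_of% h2, reassoc_of% h3, ca_nat]

theorem aa_rev' (A B C : Form P) : aa' A B C = ca (A ⋏ B) C ≫ cj (𝟙 C) (ca A B) ≫ aa C B A ≫
    cj (ca C B) (𝟙 A) ≫ ca (B ⋏ C) A := by
  have h : aa A B C ≫ (ca (A ⋏ B) C ≫ cj (𝟙 C) (ca A B) ≫ aa C B A ≫
    cj (ca C B) (𝟙 A) ≫ ca (B ⋏ C) A) = 𝟙 _ := by rw [aa_rev]; simp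
  calc _ = aa' A B C ≫ aa A B C ≫ (ca (A ⋏ B) C ≫ cj (𝟙 C) (ca A B) ≫ aa C B A ≫
    cj (ca C B) (𝟙 A) ≫ ca (B ⋏ C) A) := by rw [h]; simp
    _ = _ := by simp
end DS2

open CategoryTheory
section DS2
variable {P : Type}

theorem dd_nat_assoc {A B C D E F : Form P} (f : A ⟶ D) (g : B ⟶ E) (h : C ⟶ F) {X : Form P}
    (k : _ ⟶ X) : dd A B C ≫ dj (cj f g) h ≫ k = cj f (dj g h) ≫ dd D E F ≫ k := by
  rw [← Category.assoc, dd_nat, Category.assoc]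

def del (s V x : Form P) : (s ⋏ (V ⋎ x)) ⟶ (V ⋎ (s ⋏ x)) :=
  cj (𝟙 s) (co V x) ≫ dd s x V ≫ co (s ⋏ x) V

theorem del_nat {A B C D E F : Form P} (f : A ⟶ D) (g : B ⟶ E) (h : C ⟶ F) :
    del A B C ≫ dj g (cj f h) = cj f (dj g h) ≫ del D E F := by
  unfold del
  simp only [Category.assoc]
  rw [co_nat, dd_nat_assoc, ← Category.assoc, cj_cj, co_nat,
    ← Category.assoc (cj f (dj g h)), cj_cj, Category.id_comp, Category.comp_id]

theorem sigpull (F E Y W : Form P) : dj (𝟙 F) (ao E Y W) ≫ sig F (E ⋎ Y) W =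
    sig F E (Y ⋎ W) ≫ dj (𝟙 E) (sig F Y W) ≫ ao E Y (F ⋎ W) := by
  have h : dj (ao E Y W) (𝟙 F) ≫ ao' (E ⋎ Y) W F =
      ao' E (Y ⋎ W) F ≫ dj (𝟙 E) (ao' Y W F) ≫ ao E Y (W ⋎ F) := by
    calc _ = dj (ao E Y W) (𝟙 F) ≫ (ao' (E ⋎ Y) W F ≫ ao' E Y (W ⋎ F)) ≫ ao E Y (W ⋎ F) := by simp
      _ = _ := by rw [pentO]; simp
  rw [sig_alt, sig_alt, sig_alt]
  simp only [dj_comp_right, Category.assoc, dj_co_co_right_assoc]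
  rw [← ao_nat, ← co_nat_assoc, reassoc_of% h, dj_id]

theorem dDisj_assoc (D C B A : Form P) {X : Form P} (k : _ ⟶ X) :
    cj (𝟙 D) (ao' C B A) ≫ dd D C (B ⋎ A) ≫ k =
    dd D (C ⋎ B) A ≫ dj (dd D C B) (𝟙 A) ≫ ao' (D ⋏ C) B A ≫ k := by
  rw [← Category.assoc, dDisj']; simp only [Category.assoc]

theorem delpull (t E Y W : Form P) : cj (𝟙 t) (ao E Y W) ≫ del t (E ⋎ Y) W =
    del t E (Y ⋎ W) ≫ dj (𝟙 E) (del t Y W) ≫ ao E Y (t ⋏ W) := by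
  have hb : ao' (t ⋏ W) Y E ≫ dj (𝟙 (t ⋏ W)) (co Y E) ≫ co (t ⋏ W) (E ⋎ Y) =
      dj (co (t ⋏ W) Y) (𝟙 E) ≫ co (Y ⋎ (t ⋏ W)) E ≫ ao E Y (t ⋏ W) := by
    rw [ao_rev]; simp
  unfold del
  rw [ao_rev]
  simp only [dj_comp_right, cj_comp_right, Category.assoc, cj_ca_ca_right_assoc]
  have h1 : cj (𝟙 t) (co W (E ⋎ Y)) ≫ cj (𝟙 t) (co (E ⋎ Y) W) = 𝟙 _ := by
    rw [← cj_comp_right]; simp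
  rw [reassoc_of% h1, ← dd_nat_assoc, dDisj_assoc, cj_id, hb,
    co_nat_assoc, co_nat_assoc, co_nat_assoc, dd_nat_assoc]

theorem L5 (s E Y W : Form P) : cj (𝟙 s) (sig E Y W) ≫ dd s Y (E ⋎ W) =
    del s E (Y ⋎ W) ≫ dj (𝟙 E) (dd s Y W) ≫ sig E (s ⋏ Y) W := by
  rw [sig_alt, sig_alt]
  unfold del
  simp only [cj_comp_right, Category.assoc]
  rw [← dd_nat, dDisj_assoc, cj_id, co_nat_assoc, co_co_assoc]

theorem ddR_eq' (C B A : Form P) : ddR C B A = ca (C ⋎ B) A ≫ del A C B ≫ dj (𝟙 C) (ca A B) := by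
  rw [ddR_eq]; unfold del
  simp only [Category.assoc]
  rw [co_nat]

theorem Xcc (s t Y W : Form P) : cj (𝟙 s) (del t Y W) ≫ dd s Y (t ⋏ W) =
    tau s t (Y ⋎ W) ≫ cj (𝟙 t) (dd s Y W) ≫ del t (s ⋏ Y) W := by
  have h := dBConj' s Y W t
  rw [ddR_eq', ddR_eq'] at h
  simp only [cj_comp_right, Category.assoc] at h
  rw [← dd_nat, ← ca_nat_assoc, cj_id] at h
  have h2 : (ca (s ⋏ (Y ⋎ W)) t ≫ cj (𝟙 t) (dd s Y W) ≫ del t (s ⋏ Y) W) =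
      (aa' s (Y ⋎ W) t ≫ cj (𝟙 s) (ca (Y ⋎ W) t) ≫ cj (𝟙 s) (del t Y W) ≫ dd s Y (t ⋏ W)) := by
    have := congrArg (fun k => k ≫ dj (𝟙 (s ⋏ Y)) (ca W t)) h
    simp only [Category.assoc, ← dj_comp_right, ca_ca, dj_id, Category.comp_id] at this
    exact this
  rw [← tau_alt2]
  simp only [Category.assoc]
  rw [h2]; simp

theorem dB (s E Y W : Form P) :
    cj (𝟙 s) (ao E Y W) ≫ dd s (E ⋎ Y) W ≫ dj (del s E Y) (𝟙 W) =
    del s E (Y ⋎ W) ≫ dj (𝟙 E) (dd s Y W) ≫ ao E (s ⋏ Y) W := by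
  have h1 : dd s (Y ⋎ E) W ≫ dj (dd s Y E) (𝟙 W) =
      cj (𝟙 s) (ao' Y E W) ≫ dd s Y (E ⋎ W) ≫ ao (s ⋏ Y) E W := by
    rw [dDisj_assoc]; simp
  have h2 : sig E (s ⋏ Y) W ≫ ao (s ⋏ Y) E W ≫ dj (co (s ⋏ Y) E) (𝟙 W) = ao E (s ⋏ Y) W := by
    simp [sig]
  have h3 := L5 s E Y W
  unfold sig at h3
  simp only [cj_comp_right, Category.assoc] at h3
  conv_lhs => unfold del
  simp only [dj_comp_left]
  rw [dd_nat_assoc, reassoc_of% h1, reassoc_of% h3, ← h2]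
  simp [sig]
end DS2

open CategoryTheory
section GSHsec
variable {P : Type}

/-- Arrows into a disjunction `Y ∨ W` which first bring together, and then carry apart, a pair of
linked letters at positions `u` of `Y` and `v` of `W`. -/
inductive GSh : ∀ {Y W S : Form P}, Pos Y → Pos W → (S ⟶ Y ⋎ W) → Prop
  | nil (q r : P) : GSh (Pos.here q) (Pos.here r) (𝟙 (Form.letter q ⋎ Form.letter r))
  | pre {Y W S S' : Form P} {u : Pos Y} {v : Pos W} {K : S ⟶ Y ⋎ W} (t : S' ⟶ S) :
      GSh u v K → GSh u v (t ≫ K)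
  | yC {Y W S : Form P} {u : Pos Y} {v : Pos W} {K : S ⟶ Y ⋎ W} (s : Form P) :
      GSh u v K → GSh (Pos.cr (A := s) u) v (cj (𝟙 s) K ≫ dd s Y W)
  | yD {Y W S : Form P} {u : Pos Y} {v : Pos W} {K : S ⟶ Y ⋎ W} (s : Form P) :
      GSh u v K → GSh (Pos.dr (A := s) u) v (dj (𝟙 s) K ≫ ao s Y W)
  | yCf {s Y W S : Form P} {u : Pos Y} {v : Pos W} {K : S ⟶ (s ⋏ Y) ⋎ W} :
      GSh (Pos.cr (A := s) u) v K → GSh (Pos.cl (B := s) u) v (K ≫ dj (ca s Y) (𝟙 W))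
  | yDf {s Y W S : Form P} {u : Pos Y} {v : Pos W} {K : S ⟶ (s ⋎ Y) ⋎ W} :
      GSh (Pos.dr (A := s) u) v K → GSh (Pos.dl (B := s) u) v (K ≫ dj (co s Y) (𝟙 W))
  | wC {Y W S : Form P} {u : Pos Y} {v : Pos W} {K : S ⟶ Y ⋎ W} (s : Form P) :
      GSh u v K → GSh u (Pos.cr (A := s) v) (cj (𝟙 s) K ≫ del s Y W)
  | wD {Y W S : Form P} {u : Pos Y} {v : Pos W} {K : S ⟶ Y ⋎ W} (s : Form P) :
      GSh u v K → GSh u (Pos.dr (A := s) v) (dj (𝟙 s) K ≫ sig s Y W)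
  | wCf {s Y W S : Form P} {u : Pos Y} {v : Pos W} {K : S ⟶ Y ⋎ (s ⋏ W)} :
      GSh u (Pos.cr (A := s) v) K → GSh u (Pos.cl (B := s) v) (K ≫ dj (𝟙 Y) (ca s W))
  | wDf {s Y W S : Form P} {u : Pos Y} {v : Pos W} {K : S ⟶ Y ⋎ (s ⋎ W)} :
      GSh u (Pos.dr (A := s) v) K → GSh u (Pos.dl (B := s) v) (K ≫ dj (𝟙 Y) (co s W))

theorem GSh.cast {Y W S : Form P} {u : Pos Y} {v : Pos W} {K K' : S ⟶ Y ⋎ W}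
    (h : GSh u v K) (e : K' = K) : GSh u v K' := by rw [e]; exact h

theorem GSh.swap {Y W S : Form P} {u : Pos Y} {v : Pos W} {K : S ⟶ Y ⋎ W}
    (h : GSh u v K) : GSh v u (K ≫ co Y W) := by
  induction h with
  | nil q r => exact ((GSh.nil r q).pre (co _ _)).cast (by simp)
  | pre t _ ih => exact (ih.pre t).cast (by simp)
  | @yC Y W S u v K s _ ih =>
    refine (ih.wC s).cast ?_
    unfold del
    rw [cj_comp_right]; simp only [Category.assoc]
    rw [← Category.assoc (cj (𝟙 s) (co Y W)), ← cj_comp_right]; simp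
  | @yD Y W S u v K s _ ih =>
    refine (ih.wD s).cast ?_
    rw [dj_comp_right, ← sig_alt2]; simp
  | yCf _ ih => exact ih.wCf.cast (by simp [co_nat])
  | yDf _ ih => exact ih.wDf.cast (by simp [co_nat])
  | @wC Y W S u v K s _ ih =>
    refine (ih.yC s).cast ?_
    unfold del
    rw [cj_comp_right]; simp
  | @wD Y W S u v K s _ ih =>
    refine (ih.yD s).cast ?_
    rw [dj_comp_right, ← sig_alt2]; simp
  | wCf _ ih => exact ih.yCf.cast (by simp [co_nat])
  | wDf _ ih => exact ih.yDf.cast (by simp [co_nat])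

structure Clo {Y : Form P} (T : ∀ (W S : Form P), Pos W → (S ⟶ Y ⋎ W) → Prop) : Prop where
  pre : ∀ {W S S' : Form P} {v : Pos W} {K : S ⟶ Y ⋎ W} (t : S' ⟶ S), T W S v K → T W S' v (t ≫ K)
  wC : ∀ {W S : Form P} {v : Pos W} {K : S ⟶ Y ⋎ W} (s : Form P), T W S v K →
    T (s ⋏ W) (s ⋏ S) (Pos.cr v) (cj (𝟙 s) K ≫ del s Y W)
  wD : ∀ {W S : Form P} {v : Pos W} {K : S ⟶ Y ⋎ W} (s : Form P), T W S v K →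
    T (s ⋎ W) (s ⋎ S) (Pos.dr v) (dj (𝟙 s) K ≫ sig s Y W)
  wCf : ∀ {s W S : Form P} {v : Pos W} {K : S ⟶ Y ⋎ (s ⋏ W)}, T (s ⋏ W) S (Pos.cr v) K →
    T (W ⋏ s) S (Pos.cl v) (K ≫ dj (𝟙 Y) (ca s W))
  wDf : ∀ {s W S : Form P} {v : Pos W} {K : S ⟶ Y ⋎ (s ⋎ W)}, T (s ⋎ W) S (Pos.dr v) K →
    T (W ⋎ s) S (Pos.dl v) (K ≫ dj (𝟙 Y) (co s W))

def Base : ∀ {Y : Form P}, Pos Y → (∀ (W S : Form P), Pos W → (S ⟶ Y ⋎ W) → Prop) → Prop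
  | _, .here q, T => ∀ r : P, T (Form.letter r) (Form.letter q ⋎ Form.letter r) (Pos.here r) (𝟙 _)
  | _, @Pos.cr _ s Y u, T => ∀ (W S : Form P) (v : Pos W) (K : S ⟶ Y ⋎ W), GSh u v K →
      T W (s ⋏ S) v (cj (𝟙 s) K ≫ dd s Y W)
  | _, @Pos.dr _ s Y u, T => ∀ (W S : Form P) (v : Pos W) (K : S ⟶ Y ⋎ W), GSh u v K →
      T W (s ⋎ S) v (dj (𝟙 s) K ≫ ao s Y W)
  | _, @Pos.cl _ Y s u, T => ∀ (W S : Form P) (v : Pos W) (K : S ⟶ (s ⋏ Y) ⋎ W),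
      GSh (Pos.cr (A := s) u) v K → T W S v (K ≫ dj (ca s Y) (𝟙 W))
  | _, @Pos.dl _ Y s u, T => ∀ (W S : Form P) (v : Pos W) (K : S ⟶ (s ⋎ Y) ⋎ W),
      GSh (Pos.dr (A := s) u) v K → T W S v (K ≫ dj (co s Y) (𝟙 W))

theorem GSh.elim {Y W S : Form P} {u : Pos Y} {v : Pos W} {K : S ⟶ Y ⋎ W}
    (h : GSh u v K) : ∀ (T : ∀ (W S : Form P), Pos W → (S ⟶ Y ⋎ W) → Prop), Clo T → Base u T →
      T W S v K := by
  induction h with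
  | nil q r => intro T hT hb; exact hb r
  | pre t _ ih => intro T hT hb; exact hT.pre t (ih T hT hb)
  | yC s h ih => intro T hT hb; exact hb _ _ _ _ h
  | yD s h ih => intro T hT hb; exact hb _ _ _ _ h
  | yCf h ih => intro T hT hb; exact hb _ _ _ _ h
  | yDf h ih => intro T hT hb; exact hb _ _ _ _ h
  | wC s _ ih => intro T hT hb; exact hT.wC s (ih T hT hb)
  | wD s _ ih => intro T hT hb; exact hT.wD s (ih T hT hb)
  | wCf _ ih => intro T hT hb; exact hT.wCf (ih T hT hb)
  | wDf _ ih => intro T hT hb; exact hT.wDf (ih T hT hb)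

/-- Transport of marks along an arrow acting on the left disjunct. -/
def Tr {Y Y' : Form P} (m : Y ⟶ Y') (u : Pos Y) (u' : Pos Y') : Prop :=
  ∀ (W S : Form P) (v : Pos W) (K : S ⟶ Y ⋎ W), GSh u v K → GSh u' v (K ≫ dj m (𝟙 W))

theorem Tr.comp {Y Y' Y'' : Form P} {m : Y ⟶ Y'} {m' : Y' ⟶ Y''} {u u' u''}
    (h : Tr m u u') (h' : Tr m' u' u'') : Tr (m ≫ m') u u'' := fun W S v K hK =>
  (h' _ _ _ _ (h _ _ _ _ hK)).cast (by rw [dj_comp_left]; simp)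

theorem Tr.id {Y : Form P} (u : Pos Y) : Tr (𝟙 Y) u u := fun W S v K hK =>
  hK.cast (by simp)

theorem Tr.cast {Y Y' : Form P} {m m' : Y ⟶ Y'} {u u'} (h : Tr m u u') (e : m' = m) :
    Tr m' u u' := by rw [e]; exact h

/-- Right-side version. -/
theorem Tr.right {Y Y' : Form P} {m : Y ⟶ Y'} {u u'} (h : Tr m u u') {W S : Form P} {v : Pos W}
    {K : S ⟶ W ⋎ Y} (hK : GSh v u K) : GSh v u' (K ≫ dj (𝟙 W) m) :=
  (h _ _ _ _ hK.swap).swap.cast (by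
    simp only [Category.assoc]; rw [co_nat_assoc]; simp [dj_id])

theorem sig_dj_left {A B C E : Form P} (g : B ⟶ E) : sig A B C ≫ dj g (𝟙 (A ⋎ C)) =
    dj (𝟙 A) (dj g (𝟙 C)) ≫ sig A E C := by rw [← dj_id A C, sig_nat]
theorem del_dj_left {A B C E : Form P} (g : B ⟶ E) : del A B C ≫ dj g (𝟙 (A ⋏ C)) =
    cj (𝟙 A) (dj g (𝟙 C)) ≫ del A E C := by rw [← cj_id A C, del_nat]

theorem Tr.clo {Y Y' : Form P} (m : Y ⟶ Y') (u' : Pos Y') :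
    Clo (Y := Y) (fun W _ v K => GSh u' v (K ≫ dj m (𝟙 W))) where
  pre t h := (h.pre t).cast (by simp)
  wC s h := (h.wC s).cast (by rw [cj_comp_right]; simp [del_dj_left])
  wD s h := (h.wD s).cast (by rw [dj_comp_right]; simp [sig_dj_left])
  wCf h := h.wCf.cast (by simp [dj_dj])
  wDf h := h.wDf.cast (by simp [dj_dj])

theorem Tr.of_base {Y Y' : Form P} {m : Y ⟶ Y'} {u : Pos Y} {u' : Pos Y'}
    (h : Base u (fun W _ v K => GSh u' v (K ≫ dj m (𝟙 W)))) : Tr m u u' := fun _ _ _ _ hK =>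
  hK.elim _ (Tr.clo m u') h

theorem GSh.pull {E Y W S : Form P} {u : Pos Y} {v : Pos W} {K : S ⟶ (E ⋎ Y) ⋎ W}
    (h : GSh (Pos.dr (A := E) u) v K) : ∃ (S' : Form P) (K1 : S' ⟶ Y ⋎ W) (t : S ⟶ E ⋎ S'),
      GSh u v K1 ∧ K = t ≫ dj (𝟙 E) K1 ≫ ao E Y W := by
  refine h.elim (fun W S v K => ∃ (S' : Form P) (K1 : S' ⟶ Y ⋎ W) (t : S ⟶ E ⋎ S'),
      GSh u v K1 ∧ K = t ≫ dj (𝟙 E) K1 ≫ ao E Y W) ⟨?_, ?_, ?_, ?_, ?_⟩ ?_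
  · rintro W S S' v K t ⟨S', K1, t', h, rfl⟩
    exact ⟨S', K1, t ≫ t', h, by simp⟩
  · rintro W S v K s ⟨S', K1, t', h, rfl⟩
    refine ⟨_, _, cj (𝟙 s) t' ≫ del s E S', h.wC s, ?_⟩
    simp only [cj_comp_right, dj_comp_right, Category.assoc]
    rw [delpull, ← reassoc_of% del_nat (𝟙 s) (𝟙 E) K1]
  · rintro W S v K s ⟨S', K1, t', h, rfl⟩
    refine ⟨_, _, dj (𝟙 s) t' ≫ sig s E S', h.wD s, ?_⟩
    simp only [dj_comp_right, Category.assoc]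
    rw [sigpull, ← reassoc_of% sig_nat (𝟙 s) (𝟙 E) K1]
  · rintro s W S v K ⟨S', K1, t', h, rfl⟩
    refine ⟨_, _, t', h.wCf, ?_⟩
    simp only [dj_comp_right, Category.assoc]
    rw [← ao_nat, dj_id]
  · rintro s W S v K ⟨S', K1, t', h, rfl⟩
    refine ⟨_, _, t', h.wDf, ?_⟩
    simp only [dj_comp_right, Category.assoc]
    rw [← ao_nat, dj_id]
  · intro W S v K h
    exact ⟨_, K, 𝟙 _, h, by simp⟩

end GSHsec

open CategoryTheory
section TRsec
variable {P : Type}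

theorem Tr.ca_r (s Y : Form P) (u : Pos Y) : Tr (ca s Y) (Pos.cr u) (Pos.cl u) :=
  fun _ _ _ _ h => h.yCf
theorem Tr.co_r (s Y : Form P) (u : Pos Y) : Tr (co s Y) (Pos.dr u) (Pos.dl u) :=
  fun _ _ _ _ h => h.yDf
theorem Tr.ca_l (s Y : Form P) (u : Pos Y) : Tr (ca Y s) (Pos.cl u) (Pos.cr u) :=
  Tr.of_base fun _ _ _ _ h => h.cast (by
    rw [Category.assoc, ← dj_comp_left]; simp)
theorem Tr.co_l (s Y : Form P) (u : Pos Y) : Tr (co Y s) (Pos.dl u) (Pos.dr u) :=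
  Tr.of_base fun _ _ _ _ h => h.cast (by
    rw [Category.assoc, ← dj_comp_left]; simp)

theorem Tr.cjR {A A' B B' : Form P} (f : A ⟶ A') {g : B ⟶ B'} {u : Pos B} {u' : Pos B'}
    (h : Tr g u u') : Tr (cj f g) (Pos.cr u) (Pos.cr u') :=
  Tr.of_base fun W S v K hK => (((h _ _ _ _ hK).yC A').pre (cj f (𝟙 _))).cast (by
    rw [Category.assoc, dd_nat, ← Category.assoc, ← Category.assoc, cj_cj, cj_cj]; simp)
theorem Tr.djR {A A' B B' : Form P} (f : A ⟶ A') {g : B ⟶ B'} {u : Pos B} {u' : Pos B'}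
    (h : Tr g u u') : Tr (dj f g) (Pos.dr u) (Pos.dr u') :=
  Tr.of_base fun W S v K hK => (((h _ _ _ _ hK).yD A').pre (dj f (𝟙 _))).cast (by
    rw [Category.assoc, ao_nat, ← Category.assoc, ← Category.assoc, dj_dj, dj_dj]; simp)
theorem Tr.cjL {A A' B B' : Form P} {f : A ⟶ A'} (g : B ⟶ B') {u : Pos A} {u' : Pos A'}
    (h : Tr f u u') : Tr (cj f g) (Pos.cl u) (Pos.cl u') :=
  ((Tr.ca_l _ _ _).comp ((Tr.cjR g h).comp (Tr.ca_r _ _ _))).cast (by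
    rw [ca_nat_assoc, ca_ca, Category.comp_id])
theorem Tr.djL {A A' B B' : Form P} {f : A ⟶ A'} (g : B ⟶ B') {u : Pos A} {u' : Pos A'}
    (h : Tr f u u') : Tr (dj f g) (Pos.dl u) (Pos.dl u') :=
  ((Tr.co_l _ _ _).comp ((Tr.djR g h).comp (Tr.co_r _ _ _))).cast (by
    rw [co_nat_assoc, co_co, Category.comp_id])

theorem tau_cj {A B C F : Form P} (h : C ⟶ F) :
    tau A B C ≫ cj (𝟙 B) (cj (𝟙 A) h) = cj (𝟙 A) (cj (𝟙 B) h) ≫ tau A B F := tau_nat _ _ _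

theorem cloC {s Y Y' : Form P} (m : s ⋏ Y ⟶ Y') (u' : Pos Y') :
    Clo (Y := Y) (fun W _ v K => GSh u' v (cj (𝟙 s) K ≫ dd s Y W ≫ dj m (𝟙 W))) where
  pre t h := (h.pre (cj (𝟙 s) t)).cast (by rw [cj_comp_right]; simp)
  wC z h := ((h.wC z).pre (tau s z _)).cast (by
    simp only [cj_comp_right, Category.assoc]
    rw [reassoc_of% Xcc, ← del_dj_left, ← reassoc_of% tau_cj])
  wD z h := ((h.wD z).pre (del s z _)).cast (by
    simp only [dj_comp_right, cj_comp_right, Category.assoc]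
    rw [reassoc_of% L5, ← sig_dj_left, reassoc_of% del_nat])
  wCf h := h.wCf.cast (by
    simp only [cj_comp_right, Category.assoc]
    rw [← dd_nat_assoc, dj_dj, dj_dj]; simp)
  wDf h := h.wDf.cast (by
    simp only [cj_comp_right, Category.assoc]
    rw [← dd_nat_assoc, dj_dj, dj_dj]; simp)

theorem Tr.of_base_cr {s Y Y' : Form P} {m : s ⋏ Y ⟶ Y'} {u : Pos Y} {u' : Pos Y'}
    (h : Base u (fun W _ v K => GSh u' v (cj (𝟙 s) K ≫ dd s Y W ≫ dj m (𝟙 W)))) :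
    Tr m (Pos.cr u) u' :=
  Tr.of_base fun _ _ _ _ hK => (hK.elim _ (cloC m u') h).cast (by simp)

theorem Tr.aa3 (s t Y : Form P) (u : Pos Y) : Tr (aa s t Y) (Pos.cr (Pos.cr u)) (Pos.cr u) := by
  refine Tr.of_base_cr fun W S v K hK => ((hK.yC (s ⋏ t)).pre (aa s t _)).cast ?_
  have h := dConj' s t Y W
  have h2 : cj (𝟙 s) (dd t Y W) ≫ dd s (t ⋏ Y) W ≫ dj (aa s t Y) (𝟙 W) =
      aa s t (Y ⋎ W) ≫ dd (s ⋏ t) Y W := by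
    have e : dd (s ⋏ t) Y W = (dd (s ⋏ t) Y W ≫ dj (aa' s t Y) (𝟙 W)) ≫ dj (aa s t Y) (𝟙 W) := by
      rw [Category.assoc, ← dj_comp_left]; simp
    rw [e, h]; simp
  simp only [cj_comp_right, Category.assoc]
  rw [h2, ← cj_id s t, aa_nat_assoc]

theorem Tr.aaInv3 (s t Y : Form P) (u : Pos Y) : Tr (aa' s t Y) (Pos.cr u) (Pos.cr (Pos.cr u)) := by
  refine Tr.of_base fun W S v K hK => (((hK.yC t).yC s).pre (aa' s t _)).cast ?_
  rw [Category.assoc, dConj', cj_comp_right]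
  simp only [Category.assoc]
  rw [aa'_nat_assoc, cj_id]

theorem Tr.aa1 (A B C : Form P) (u : Pos A) : Tr (aa A B C) (Pos.cl u) (Pos.cl (Pos.cl u)) :=
  ((Tr.ca_l _ _ _).comp ((Tr.cjR _ (Tr.id _)).comp ((Tr.aaInv3 _ _ _ _).comp
    ((Tr.cjR _ (Tr.ca_r _ _ _)).comp (Tr.ca_r _ _ _))))).cast (aa_rev A B C)

theorem Tr.aaInv1 (A B C : Form P) (u : Pos A) : Tr (aa' A B C) (Pos.cl (Pos.cl u)) (Pos.cl u) :=
  ((Tr.ca_l _ _ _).comp ((Tr.cjR _ (Tr.ca_l _ _ _)).comp ((Tr.aa3 _ _ _ _).comp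
    ((Tr.cjR _ (Tr.id _)).comp (Tr.ca_r _ _ _))))).cast (aa_rev' A B C)

theorem aa_hex (A B C : Form P) : aa A B C = cj (𝟙 A) (ca B C) ≫ aa A C B ≫ ca (A ⋏ C) B ≫
    aa B A C ≫ cj (ca B A) (𝟙 C) := by
  rw [reassoc_of% tau_alt2 A B C]; simp [tau]

theorem Tr.aa2 (A B C : Form P) (u : Pos B) :
    Tr (aa A B C) (Pos.cr (Pos.cl u)) (Pos.cl (Pos.cr u)) :=
  ((Tr.cjR _ (Tr.ca_l _ _ _)).comp ((Tr.aa3 _ _ _ _).comp ((Tr.ca_r _ _ _).comp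
    ((Tr.aa1 _ _ _ _).comp (Tr.cjL _ (Tr.ca_l _ _ _)))))).cast (aa_hex A B C)

theorem Tr.aaInv2 (A B C : Form P) (u : Pos B) :
    Tr (aa' A B C) (Pos.cl (Pos.cr u)) (Pos.cr (Pos.cl u)) :=
  ((Tr.cjL _ (Tr.ca_r _ _ _)).comp ((Tr.aaInv1 _ _ _ _).comp ((Tr.ca_l _ _ _).comp
    ((Tr.aaInv3 _ _ _ _).comp (Tr.cjR _ (Tr.ca_r _ _ _)))))).cast (hexA B A C).symm

theorem pentO' (s t Y W : Form P) : dj (𝟙 s) (ao t Y W) ≫ ao s (t ⋎ Y) W ≫ dj (ao s t Y) (𝟙 W) =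
    ao s t (Y ⋎ W) ≫ ao (s ⋎ t) Y W := by
  calc _ = dj (𝟙 s) (ao t Y W) ≫ ao s (t ⋎ Y) W ≫ dj (ao s t Y) (𝟙 W) ≫
        (ao' (s ⋎ t) Y W ≫ ao' s t (Y ⋎ W)) ≫ ao s t (Y ⋎ W) ≫ ao (s ⋎ t) Y W := by simp
    _ = _ := by rw [pentO]; simp

theorem Tr.ao3 (s t Y : Form P) (u : Pos Y) : Tr (ao s t Y) (Pos.dr (Pos.dr u)) (Pos.dr u) := by
  intro W S v K hK
  obtain ⟨S1, K1, t1, h1, rfl⟩ := hK.pull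
  obtain ⟨S2, K2, t2, h2, rfl⟩ := h1.pull
  refine ((h2.yD (s ⋎ t)).pre (t1 ≫ dj (𝟙 s) t2 ≫ ao s t _)).cast ?_
  simp only [dj_comp_right, Category.assoc]
  rw [pentO', ← dj_id s t, ao_nat_assoc]

theorem Tr.aoInv3 (s t Y : Form P) (u : Pos Y) : Tr (ao' s t Y) (Pos.dr u) (Pos.dr (Pos.dr u)) := by
  refine Tr.of_base fun W S v K hK => (((hK.yD t).yD s).pre (ao' s t _)).cast ?_
  have h : ao (s ⋎ t) Y W ≫ dj (ao' s t Y) (𝟙 W) =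
      ao' s t (Y ⋎ W) ≫ dj (𝟙 s) (ao t Y W) ≫ ao s (t ⋎ Y) W := by
    calc _ = ao' s t (Y ⋎ W) ≫ (ao s t (Y ⋎ W) ≫ ao (s ⋎ t) Y W) ≫ dj (ao' s t Y) (𝟙 W) := by simp
      _ = _ := by rw [← pentO']; simp
  rw [Category.assoc, h, dj_comp_right]
  simp only [Category.assoc]
  rw [ao'_nat_assoc, dj_id]

theorem Tr.ao1 (A B C : Form P) (u : Pos A) : Tr (ao A B C) (Pos.dl u) (Pos.dl (Pos.dl u)) :=
  ((Tr.co_l _ _ _).comp ((Tr.djR _ (Tr.id _)).comp ((Tr.aoInv3 _ _ _ _).comp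
    ((Tr.djR _ (Tr.co_r _ _ _)).comp (Tr.co_r _ _ _))))).cast (ao_rev A B C)

theorem Tr.aoInv1 (A B C : Form P) (u : Pos A) : Tr (ao' A B C) (Pos.dl (Pos.dl u)) (Pos.dl u) :=
  ((Tr.co_l _ _ _).comp ((Tr.djR _ (Tr.co_l _ _ _)).comp ((Tr.ao3 _ _ _ _).comp
    ((Tr.djR _ (Tr.id _)).comp (Tr.co_r _ _ _))))).cast (ao_rev' A B C)

theorem ao_hex (A B C : Form P) : ao A B C = dj (𝟙 A) (co B C) ≫ ao A C B ≫ co (A ⋎ C) B ≫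
    ao B A C ≫ dj (co B A) (𝟙 C) := by
  rw [reassoc_of% sig_alt2 A B C]; simp [sig]

theorem Tr.ao2 (A B C : Form P) (u : Pos B) :
    Tr (ao A B C) (Pos.dr (Pos.dl u)) (Pos.dl (Pos.dr u)) :=
  ((Tr.djR _ (Tr.co_l _ _ _)).comp ((Tr.ao3 _ _ _ _).comp ((Tr.co_r _ _ _).comp
    ((Tr.ao1 _ _ _ _).comp (Tr.djL _ (Tr.co_l _ _ _)))))).cast (ao_hex A B C)

theorem Tr.aoInv2 (A B C : Form P) (u : Pos B) :
    Tr (ao' A B C) (Pos.dl (Pos.dr u)) (Pos.dr (Pos.dl u)) :=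
  ((Tr.djL _ (Tr.co_r _ _ _)).comp ((Tr.aoInv1 _ _ _ _).comp ((Tr.co_l _ _ _).comp
    ((Tr.aoInv3 _ _ _ _).comp (Tr.djR _ (Tr.co_r _ _ _)))))).cast (hexO B A C).symm

theorem Tr.dd3 (A B C : Form P) (u : Pos C) : Tr (dd A B C) (Pos.cr (Pos.dr u)) (Pos.dr u) := by
  refine Tr.of_base fun W S v K hK => ?_
  obtain ⟨S1, K1, t1, h1, rfl⟩ := hK.pull
  refine ((h1.yD (A ⋏ B)).pre (cj (𝟙 A) t1 ≫ dd A B _)).cast ?_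
  have h : cj (𝟙 A) (ao B C W) ≫ dd A (B ⋎ C) W ≫ dj (dd A B C) (𝟙 W) =
      dd A B (C ⋎ W) ≫ ao (A ⋏ B) C W := by
    have e : dd A (B ⋎ C) W ≫ dj (dd A B C) (𝟙 W) =
      cj (𝟙 A) (ao' B C W) ≫ dd A B (C ⋎ W) ≫ ao (A ⋏ B) C W := by rw [dDisj_assoc]; simp
    have e2 : cj (𝟙 A) (ao B C W) ≫ cj (𝟙 A) (ao' B C W) = 𝟙 _ := by rw [← cj_comp_right]; simp
    rw [e, reassoc_of% e2]
  simp only [cj_comp_right, Category.assoc]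
  rw [h, ← cj_id A B, dd_nat_assoc]

theorem Tr.del3 (s E Y : Form P) (u : Pos Y) :
    Tr (del s E Y) (Pos.cr (Pos.dr u)) (Pos.dr (Pos.cr u)) := by
  refine Tr.of_base fun W S v K hK => ?_
  obtain ⟨S1, K1, t1, h1, rfl⟩ := hK.pull
  refine (((h1.yC s).yD E).pre (cj (𝟙 s) t1 ≫ del s E _)).cast ?_
  simp only [cj_comp_right, dj_comp_right, Category.assoc]
  rw [dB, reassoc_of% del_nat (𝟙 s) (𝟙 E) K1]

theorem dd_eq_del (A B C : Form P) : dd A B C = cj (𝟙 A) (co B C) ≫ del A C B ≫ co C (A ⋏ B) := by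
  have e2 : cj (𝟙 A) (co B C) ≫ cj (𝟙 A) (co C B) = 𝟙 _ := by rw [← cj_comp_right]; simp
  unfold del
  simp only [Category.assoc, co_co, Category.comp_id]
  rw [reassoc_of% e2]

theorem Tr.dd2 (A B C : Form P) (u : Pos B) :
    Tr (dd A B C) (Pos.cr (Pos.dl u)) (Pos.dl (Pos.cr u)) :=
  ((Tr.cjR _ (Tr.co_l _ _ _)).comp ((Tr.del3 _ _ _ _).comp (Tr.co_r _ _ _))).cast
    (dd_eq_del A B C)

theorem Tr.ddR3 (C B A : Form P) (u : Pos A) : Tr (ddR C B A) (Pos.cr u) (Pos.dr (Pos.cr u)) := by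
  refine Tr.of_base fun W S v K hK => (((hK.yC B).yD C).pre (ddR C B _)).cast ?_
  have h := dBDisj' C B A W
  have h2 : dd (C ⋎ B) A W ≫ dj (ddR C B A) (𝟙 W) =
      ddR C B (A ⋎ W) ≫ dj (𝟙 C) (dd B A W) ≫ ao C (B ⋏ A) W := by
    rw [reassoc_of% h]; simp
  have h3 : ddR C B S ≫ dj (𝟙 C) (cj (𝟙 B) K) = cj (𝟙 (C ⋎ B)) K ≫ ddR C B (A ⋎ W) := by
    rw [ddR_eq', ddR_eq']
    simp only [Category.assoc]
    rw [← dj_comp_right, ca_nat, dj_comp_right, reassoc_of% del_nat, dj_id, ca_nat_assoc]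
  rw [Category.assoc, h2, dj_comp_right, ← reassoc_of% h3]
  simp

theorem Tr.dd1 (A B C : Form P) (u : Pos A) : Tr (dd A B C) (Pos.cl u) (Pos.dl (Pos.cl u)) :=
  ((Tr.cjL (co B C) (Tr.id _)).comp ((Tr.ca_l _ _ _).comp ((Tr.ddR3 C B A _).comp
    ((Tr.djR (𝟙 C) (Tr.ca_r _ _ _)).comp (Tr.co_r _ _ _))))).cast (by
    have e : dj (𝟙 C) (ca A B) ≫ dj (𝟙 C) (ca B A) = 𝟙 _ := by rw [← dj_comp_right]; simp
    rw [dd_eq_del, ddR_eq']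
    simp only [Category.assoc, ca_ca_assoc]
    rw [reassoc_of% e])

theorem Tr.map {A B : Form P} (f : Term P A B) (u : Pos A) : Tr f.cls u (f.map u) := by
  induction f with
  | id A => exact Tr.id u
  | comp g f ihg ihf => exact (ihf u).comp (ihg _)
  | conj f g ihf ihg =>
    rcases u with _ | u | u
    · exact Tr.cjL g.cls (ihf u)
    · exact Tr.cjR f.cls (ihg u)
  | disj f g ihf ihg =>
    rcases u with _ | _ | _ | u | u
    · exact Tr.djL g.cls (ihf u)
    · exact Tr.djR f.cls (ihg u)
  | bConjTo A B C =>
    rcases u with _ | u | (_ | u | u)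
    · exact Tr.aa1 A B C u
    · exact Tr.aa2 A B C u
    · exact Tr.aa3 A B C u
  | bConjFrom A B C =>
    rcases u with _ | (_ | u | u) | u
    · exact Tr.aaInv1 A B C u
    · exact Tr.aaInv2 A B C u
    · exact Tr.aaInv3 A B C u
  | bDisjTo A B C =>
    rcases u with _ | _ | _ | u | (_ | _ | _ | u | u)
    · exact Tr.ao1 A B C u
    · exact Tr.ao2 A B C u
    · exact Tr.ao3 A B C u
  | bDisjFrom A B C =>
    rcases u with _ | _ | _ | (_ | _ | _ | u | u) | u
    · exact Tr.aoInv1 A B C u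
    · exact Tr.aoInv2 A B C u
    · exact Tr.aoInv3 A B C u
  | cConj A B =>
    rcases u with _ | u | u
    · exact Tr.ca_l B A u
    · exact Tr.ca_r A B u
  | cDisj A B =>
    rcases u with _ | _ | _ | u | u
    · exact Tr.co_l A B u
    · exact Tr.co_r B A u
  | d A B C =>
    rcases u with _ | u | (_ | _ | _ | u | u)
    · exact Tr.dd1 A B C u
    · exact Tr.dd2 A B C u
    · exact Tr.dd3 A B C u

end TRsec

open CategoryTheory
section GSPsec
variable {P : Type}

inductive GSp : ∀ {B S : Form P}, Pos B → Pos B → (S ⟶ B) → Prop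
  | pre {B S S' : Form P} {u v : Pos B} {K : S ⟶ B} (t : S' ⟶ S) : GSp u v K → GSp u v (t ≫ K)
  | root {Y W S : Form P} {u : Pos Y} {v : Pos W} {K : S ⟶ Y ⋎ W} :
      GSh u v K → GSp (Pos.dl u) (Pos.dr v) K
  | root' {Y W S : Form P} {u : Pos Y} {v : Pos W} {K : S ⟶ Y ⋎ W} :
      GSh u v K → GSp (Pos.dr v) (Pos.dl u) K
  | cL {B S : Form P} {u v : Pos B} {K : S ⟶ B} (C : Form P) :
      GSp u v K → GSp (Pos.cl (B := C) u) (Pos.cl v) (cj K (𝟙 C))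
  | cR {B S : Form P} {u v : Pos B} {K : S ⟶ B} (C : Form P) :
      GSp u v K → GSp (Pos.cr (A := C) u) (Pos.cr v) (cj (𝟙 C) K)
  | dL {B S : Form P} {u v : Pos B} {K : S ⟶ B} (C : Form P) :
      GSp u v K → GSp (Pos.dl (B := C) u) (Pos.dl v) (dj K (𝟙 C))
  | dR {B S : Form P} {u v : Pos B} {K : S ⟶ B} (C : Form P) :
      GSp u v K → GSp (Pos.dr (A := C) u) (Pos.dr v) (dj (𝟙 C) K)

theorem GSp.cast {B S : Form P} {u v : Pos B} {K K' : S ⟶ B}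
    (h : GSp u v K) (e : K' = K) : GSp u v K' := by rw [e]; exact h

theorem GSp.symm {B S : Form P} {u v : Pos B} {K : S ⟶ B} (h : GSp u v K) : GSp v u K := by
  induction h with
  | pre t _ ih => exact ih.pre t
  | root h => exact GSp.root' h
  | root' h => exact GSp.root h
  | cL C _ ih => exact ih.cL C
  | cR C _ ih => exact ih.cR C
  | dL C _ ih => exact ih.dL C
  | dR C _ ih => exact ih.dR C

def GInv {S : Form P} : ∀ {B : Form P}, Pos B → Pos B → (S ⟶ B) → Prop
  | _, @Pos.cl _ B C u, .cl v, K => ∃ (S' : Form P) (K' : S' ⟶ B) (t : S ⟶ S' ⋏ C),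
      GSp u v K' ∧ K = t ≫ cj K' (𝟙 C)
  | _, @Pos.cr _ C B u, .cr v, K => ∃ (S' : Form P) (K' : S' ⟶ B) (t : S ⟶ C ⋏ S'),
      GSp u v K' ∧ K = t ≫ cj (𝟙 C) K'
  | _, @Pos.dl _ B C u, .dl v, K => ∃ (S' : Form P) (K' : S' ⟶ B) (t : S ⟶ S' ⋎ C),
      GSp u v K' ∧ K = t ≫ dj K' (𝟙 C)
  | _, @Pos.dr _ C B u, .dr v, K => ∃ (S' : Form P) (K' : S' ⟶ B) (t : S ⟶ C ⋎ S'),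
      GSp u v K' ∧ K = t ≫ dj (𝟙 C) K'
  | _, .dl u, .dr v, K => GSh u v K
  | _, .dr v, .dl u, K => GSh u v K
  | _, .cl _, .cr _, _ => False
  | _, .cr _, .cl _, _ => False
  | _, .here _, .here _, _ => False

theorem GSp.inv {B S : Form P} {u v : Pos B} {K : S ⟶ B} (h : GSp u v K) : GInv u v K := by
  induction h with
  | @pre B S S' u v K t _ ih =>
    cases u with
    | here q => cases v with | here r => exact ih
    | cl u =>
      cases v with
      | cl v => obtain ⟨S1, K1, t1, h, rfl⟩ := ih; exact ⟨S1, K1, t ≫ t1, h, by simp⟩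
      | cr v => exact ih
    | cr u =>
      cases v with
      | cr v => obtain ⟨S1, K1, t1, h, rfl⟩ := ih; exact ⟨S1, K1, t ≫ t1, h, by simp⟩
      | cl v => exact ih
    | dl u =>
      cases v with
      | dl v => obtain ⟨S1, K1, t1, h, rfl⟩ := ih; exact ⟨S1, K1, t ≫ t1, h, by simp⟩
      | dr v => exact GSh.pre t ih
    | dr u =>
      cases v with
      | dr v => obtain ⟨S1, K1, t1, h, rfl⟩ := ih; exact ⟨S1, K1, t ≫ t1, h, by simp⟩
      | dl v => exact GSh.pre t ih
  | root h => exact h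
  | root' h => exact h
  | cL C h _ => exact ⟨_, _, 𝟙 _, h, by simp⟩
  | cR C h _ => exact ⟨_, _, 𝟙 _, h, by simp⟩
  | dL C h _ => exact ⟨_, _, 𝟙 _, h, by simp⟩
  | dR C h _ => exact ⟨_, _, 𝟙 _, h, by simp⟩

def TrP {B B' : Form P} (m : B ⟶ B') (u v : Pos B) (u' v' : Pos B') : Prop :=
  ∀ (S : Form P) (K : S ⟶ B), GSp u v K → GSp u' v' (K ≫ m)

theorem TrP.symm {B B' : Form P} {m : B ⟶ B'} {u v : Pos B} {u' v' : Pos B'}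
    (h : TrP m u v u' v') : TrP m v u v' u' := fun _ _ hK => (h _ _ hK.symm).symm
theorem TrP.comp {B B' B'' : Form P} {m : B ⟶ B'} {m' : B' ⟶ B''} {u v u' v' u'' v''}
    (h : TrP m u v u' v') (h' : TrP m' u' v' u'' v'') : TrP (m ≫ m') u v u'' v'' :=
  fun _ _ hK => (h' _ _ (h _ _ hK)).cast (by simp)
theorem TrP.cast {B B' : Form P} {m m' : B ⟶ B'} {u v u' v'} (h : TrP m u v u' v') (e : m' = m) :
    TrP m' u v u' v' := by rw [e]; exact h

theorem TrP.cjL {A A' B B' : Form P} {f : A ⟶ A'} (g : B ⟶ B') {u v u' v'}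
    (h : TrP f u v u' v') : TrP (cj f g) (Pos.cl u) (Pos.cl v) (Pos.cl u') (Pos.cl v') := by
  intro S K hK
  obtain ⟨S1, K1, t1, h1, rfl⟩ := hK.inv
  exact (((h _ _ h1).cL B').pre (t1 ≫ cj (𝟙 _) g)).cast (by simp [cj_cj])
theorem TrP.cjR {A A' B B' : Form P} (f : A ⟶ A') {g : B ⟶ B'} {u v u' v'}
    (h : TrP g u v u' v') : TrP (cj f g) (Pos.cr u) (Pos.cr v) (Pos.cr u') (Pos.cr v') := by
  intro S K hK
  obtain ⟨S1, K1, t1, h1, rfl⟩ := hK.inv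
  exact (((h _ _ h1).cR A').pre (t1 ≫ cj f (𝟙 _))).cast (by simp [cj_cj])
theorem TrP.djL {A A' B B' : Form P} {f : A ⟶ A'} (g : B ⟶ B') {u v u' v'}
    (h : TrP f u v u' v') : TrP (dj f g) (Pos.dl u) (Pos.dl v) (Pos.dl u') (Pos.dl v') := by
  intro S K hK
  obtain ⟨S1, K1, t1, h1, rfl⟩ := hK.inv
  exact (((h _ _ h1).dL B').pre (t1 ≫ dj (𝟙 _) g)).cast (by simp [dj_dj])
theorem TrP.djR {A A' B B' : Form P} (f : A ⟶ A') {g : B ⟶ B'} {u v u' v'}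
    (h : TrP g u v u' v') : TrP (dj f g) (Pos.dr u) (Pos.dr v) (Pos.dr u') (Pos.dr v') := by
  intro S K hK
  obtain ⟨S1, K1, t1, h1, rfl⟩ := hK.inv
  exact (((h _ _ h1).dR A').pre (t1 ≫ dj f (𝟙 _))).cast (by simp [dj_dj])
theorem TrP.djLR {A A' B B' : Form P} {f : A ⟶ A'} {g : B ⟶ B'} {u v u' v'}
    (h : Tr f u u') (h' : Tr g v v') :
    TrP (dj f g) (Pos.dl u) (Pos.dr v) (Pos.dl u') (Pos.dr v') := by
  intro S K hK
  exact (GSp.root (h'.right (h _ _ _ _ hK.inv))).cast (by simp [dj_dj])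

/-- All marks are transported by the term. -/
def M {A B : Form P} (f : Term P A B) : Prop := ∀ u v, TrP f.cls u v (f.map u) (f.map v)

theorem M.comp {A B C : Form P} {g : Term P B C} {f : Term P A B} (hg : M g) (hf : M f) :
    M (g ⬝ f) := fun u v => (hf u v).comp (hg _ _)
theorem M.id (A : Form P) : M (Term.id A) := fun _ _ _ _ h => h.cast (Category.comp_id _)
theorem M.eqv {A B : Form P} {f g : Term P A B} (hf : M f) (h : Eqv g f) : M g := by
  intro u v
  rw [h.map_eq, h.map_eq]
  exact (hf u v).cast (Term.cls_eq.2 h)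
theorem M.conj {A B D E : Form P} {f : Term P A D} {g : Term P B E} (hf : M f) (hg : M g) :
    M (f ⊼ g) := by
  intro u v
  rcases u with _ | u | u <;> rcases v with _ | v | v
  · exact TrP.cjL g.cls (hf u v)
  · exact fun _ _ h => h.inv.elim
  · exact fun _ _ h => h.inv.elim
  · exact TrP.cjR f.cls (hg u v)
theorem M.disj {A B D E : Form P} {f : Term P A D} {g : Term P B E} (hf : M f) (hg : M g) :
    M (f ⊽ g) := by
  intro u v
  rcases u with _ | _ | _ | u | u <;> rcases v with _ | _ | _ | v | v
  · exact TrP.djL g.cls (hf u v)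
  · exact TrP.djLR (Tr.map f u) (Tr.map g v)
  · exact (TrP.djLR (Tr.map f v) (Tr.map g u)).symm
  · exact TrP.djR f.cls (hg u v)

theorem M.cConj (A B : Form P) : M (Term.cConj A B) := by
  intro u v
  rcases u with _ | u | u <;> rcases v with _ | v | v
  · intro S K hK
    obtain ⟨S1, K1, t1, h1, rfl⟩ := hK.inv
    exact ((h1.cR _).pre (t1 ≫ ca _ _)).cast (by simp only [Category.assoc]; rw [ca_nat]; rfl)
  · exact fun _ _ h => h.inv.elim
  · exact fun _ _ h => h.inv.elim
  · intro S K hK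
    obtain ⟨S1, K1, t1, h1, rfl⟩ := hK.inv
    exact ((h1.cL _).pre (t1 ≫ ca _ _)).cast (by simp only [Category.assoc]; rw [ca_nat]; rfl)

theorem M.cDisj (A B : Form P) : M (Term.cDisj A B) := by
  intro u v
  rcases u with _ | _ | _ | u | u <;> rcases v with _ | _ | _ | v | v
  · intro S K hK
    obtain ⟨S1, K1, t1, h1, rfl⟩ := hK.inv
    exact ((h1.dR _).pre (t1 ≫ co _ _)).cast (by simp only [Category.assoc]; rw [co_nat]; rfl)
  · intro S K hK
    exact GSp.root' (GSh.swap hK.inv)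
  · intro S K hK
    exact GSp.root (GSh.swap hK.inv)
  · intro S K hK
    obtain ⟨S1, K1, t1, h1, rfl⟩ := hK.inv
    exact ((h1.dL _).pre (t1 ≫ co _ _)).cast (by simp only [Category.assoc]; rw [co_nat]; rfl)

theorem M.bConjTo (A B C : Form P) : M (Term.bConjTo A B C) := by
  have key : ∀ (S : Form P) (K : S ⟶ A ⋏ (B ⋏ C)) u v, ¬ GSp (Pos.cr (Pos.cl u)) (Pos.cr (Pos.cr v)) K := by
    intro S K u v hK
    obtain ⟨S1, K1, t1, h1, rfl⟩ := hK.inv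
    exact h1.inv
  intro u v
  rcases u with _ | u | (_ | u | u) <;> rcases v with _ | v | (_ | v | v)
  · intro S K hK
    obtain ⟨S1, K1, t1, h1, rfl⟩ := hK.inv
    exact (((h1.cL B).cL C).pre (t1 ≫ aa _ _ _)).cast (by
      simp only [Category.assoc]; rw [aa_nat, cj_id]; rfl)
  · exact fun _ _ h => h.inv.elim
  · exact fun _ _ h => h.inv.elim
  · exact fun _ _ h => h.inv.elim
  · intro S K hK
    obtain ⟨S1, K1, t1, h1, rfl⟩ := hK.inv
    obtain ⟨S2, K2, t2, h2, rfl⟩ := h1.inv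
    exact (((h2.cR A).cL C).pre (t1 ≫ cj (𝟙 _) t2 ≫ aa _ _ _)).cast (by
      simp only [Category.assoc, cj_comp_right]; rw [aa_nat]; rfl)
  · exact fun _ _ h => (key _ _ _ _ h).elim
  · exact fun _ _ h => h.inv.elim
  · exact fun _ _ h => (key _ _ _ _ h.symm).elim
  · intro S K hK
    obtain ⟨S1, K1, t1, h1, rfl⟩ := hK.inv
    obtain ⟨S2, K2, t2, h2, rfl⟩ := h1.inv
    exact ((h2.cR (A ⋏ B)).pre (t1 ≫ cj (𝟙 _) t2 ≫ aa _ _ _)).cast (by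
      simp only [Category.assoc, cj_comp_right]; rw [← cj_id A B, aa_nat]; rfl)

theorem M.bConjFrom (A B C : Form P) : M (Term.bConjFrom A B C) := by
  refine M.eqv (f := Term.cConj (B ⋏ C) A ⬝ (Term.cConj C B ⊼ Term.id A) ⬝ Term.bConjTo C B A ⬝
    (Term.id C ⊼ Term.cConj A B) ⬝ Term.cConj (A ⋏ B) C) ?_ (Term.cls_eq.1 ?_)
  · exact M.comp (M.cConj _ _) (M.comp (M.conj (M.cConj _ _) (M.id _)) (M.comp (M.bConjTo _ _ _)
      (M.comp (M.conj (M.id _) (M.cConj _ _)) (M.cConj _ _))))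
  · refine (aa_rev' A B C).trans ?_
    simp only [cls_comp, cls_conj, cls_id, Category.assoc]
    rfl

theorem TrP.ao23 (A B C : Form P) (u : Pos B) (v : Pos C) :
    TrP (ao A B C) (Pos.dr (Pos.dl u)) (Pos.dr (Pos.dr v)) (Pos.dl (Pos.dr u)) (Pos.dr v) := by
  intro S K hK
  obtain ⟨S1, K1, t1, h1, rfl⟩ := hK.inv
  exact ((GSp.root (GSh.yD A h1.inv)).pre t1).cast (by simp)

theorem TrP.ao12 (A B C : Form P) (u : Pos A) (v : Pos B) :
    TrP (ao A B C) (Pos.dl u) (Pos.dr (Pos.dl v)) (Pos.dl (Pos.dl u)) (Pos.dl (Pos.dr v)) := by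
  intro S K hK
  have h1 := (Tr.co_l C B v).right hK.inv
  obtain ⟨S1, K1, t1, h2, e⟩ := h1.swap.pull
  refine ((GSp.dL C (GSp.root h2.swap)).pre (t1 ≫ co C _)).cast ?_
  have e1 : K = ((K ≫ dj (𝟙 A) (co B C)) ≫ co A (C ⋎ B)) ≫ co (C ⋎ B) A ≫ dj (𝟙 A) (co C B) := by
    simp
  rw [e1, e, ao_rev A B C]
  simp only [Category.assoc]
  rw [co_nat, dj_comp_right]
  have e2 : co (C ⋎ B) A ≫ dj (𝟙 A) (co C B) ≫ co A (B ⋎ C) ≫ dj (co B C) (𝟙 A) = 𝟙 _ := by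
    rw [co_nat_assoc]; simp
  rw [reassoc_of% e2]
  simp

theorem TrP.ao13 (A B C : Form P) (u : Pos A) (v : Pos C) :
    TrP (ao A B C) (Pos.dl u) (Pos.dr (Pos.dr v)) (Pos.dl (Pos.dl u)) (Pos.dr v) :=
  ((TrP.djLR (Tr.id u) (Tr.co_r B C v)).comp ((TrP.ao12 A C B u v).comp
    ((M.cDisj B (A ⋎ C) (Pos.dl (Pos.dl u)) (Pos.dl (Pos.dr v))).comp
    ((TrP.ao23 B A C u v).comp (TrP.djLR (Tr.co_r B A u) (Tr.id v)))))).cast (ao_hex A B C)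

theorem M.bDisjTo (A B C : Form P) : M (Term.bDisjTo A B C) := by
  intro u v
  rcases u with _ | _ | _ | u | (_ | _ | _ | u | u) <;>
    rcases v with _ | _ | _ | v | (_ | _ | _ | v | v)
  · intro S K hK
    obtain ⟨S1, K1, t1, h1, rfl⟩ := hK.inv
    exact (((h1.dL B).dL C).pre (t1 ≫ ao _ _ _)).cast (by
      simp only [Category.assoc]; rw [ao_nat, dj_id]; rfl)
  · exact TrP.ao12 A B C u v
  · exact TrP.ao13 A B C u v
  · exact (TrP.ao12 A B C v u).symm
  · intro S K hK
    obtain ⟨S1, K1, t1, h1, rfl⟩ := hK.inv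
    obtain ⟨S2, K2, t2, h2, rfl⟩ := h1.inv
    exact (((h2.dR A).dL C).pre (t1 ≫ dj (𝟙 _) t2 ≫ ao _ _ _)).cast (by
      simp only [Category.assoc, dj_comp_right]; rw [ao_nat]; rfl)
  · exact TrP.ao23 A B C u v
  · exact (TrP.ao13 A B C v u).symm
  · exact (TrP.ao23 A B C v u).symm
  · intro S K hK
    obtain ⟨S1, K1, t1, h1, rfl⟩ := hK.inv
    obtain ⟨S2, K2, t2, h2, rfl⟩ := h1.inv
    exact ((h2.dR (A ⋎ B)).pre (t1 ≫ dj (𝟙 _) t2 ≫ ao _ _ _)).cast (by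
      simp only [Category.assoc, dj_comp_right]; rw [← dj_id A B, ao_nat]; rfl)

theorem M.bDisjFrom (A B C : Form P) : M (Term.bDisjFrom A B C) := by
  refine M.eqv (f := Term.cDisj A (B ⋎ C) ⬝ (Term.cDisj B C ⊽ Term.id A) ⬝ Term.bDisjTo C B A ⬝
    (Term.id C ⊽ Term.cDisj B A) ⬝ Term.cDisj C (A ⋎ B)) ?_ (Term.cls_eq.1 ?_)
  · exact M.comp (M.cDisj _ _) (M.comp (M.disj (M.cDisj _ _) (M.id _)) (M.comp (M.bDisjTo _ _ _)
      (M.comp (M.disj (M.id _) (M.cDisj _ _)) (M.cDisj _ _))))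
  · refine (ao_rev' A B C).trans ?_
    simp only [cls_comp, cls_disj, cls_id, Category.assoc]
    rfl

theorem TrP.dd23 (A B C : Form P) (u : Pos B) (v : Pos C) :
    TrP (dd A B C) (Pos.cr (Pos.dl u)) (Pos.cr (Pos.dr v)) (Pos.dl (Pos.cr u)) (Pos.dr v) := by
  intro S K hK
  obtain ⟨S1, K1, t1, h1, rfl⟩ := hK.inv
  exact ((GSp.root (GSh.yC A h1.inv)).pre t1).cast (by simp)

theorem M.d (A B C : Form P) : M (Term.d A B C) := by
  intro u v
  rcases u with _ | u | (_ | _ | _ | u | u) <;>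
    rcases v with _ | v | (_ | _ | _ | v | v)
  · intro S K hK
    obtain ⟨S1, K1, t1, h1, rfl⟩ := hK.inv
    exact (((h1.cL B).dL C).pre (t1 ≫ dd _ _ _)).cast (by
      simp only [Category.assoc]; rw [dd_nat, dj_id]; rfl)
  · exact fun _ _ h => h.inv.elim
  · exact fun _ _ h => h.inv.elim
  · exact fun _ _ h => h.inv.elim
  · intro S K hK
    obtain ⟨S1, K1, t1, h1, rfl⟩ := hK.inv
    obtain ⟨S2, K2, t2, h2, rfl⟩ := h1.inv
    exact (((h2.cR A).dL C).pre (t1 ≫ cj (𝟙 _) t2 ≫ dd _ _ _)).cast (by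
      simp only [Category.assoc, cj_comp_right]; rw [dd_nat]; rfl)
  · exact TrP.dd23 A B C u v
  · exact fun _ _ h => h.inv.elim
  · exact (TrP.dd23 A B C v u).symm
  · intro S K hK
    obtain ⟨S1, K1, t1, h1, rfl⟩ := hK.inv
    obtain ⟨S2, K2, t2, h2, rfl⟩ := h1.inv
    exact ((h2.dR (A ⋏ B)).pre (t1 ≫ cj (𝟙 _) t2 ≫ dd _ _ _)).cast (by
      simp only [Category.assoc, cj_comp_right]; rw [← cj_id A B, dd_nat]; rfl)

theorem M.all {A B : Form P} (f : Term P A B) : M f := by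
  induction f with
  | id A => exact M.id A
  | comp g f ihg ihf => exact M.comp ihg ihf
  | conj f g ihf ihg => exact M.conj ihf ihg
  | disj f g ihf ihg => exact M.disj ihf ihg
  | bConjTo A B C => exact M.bConjTo A B C
  | bConjFrom A B C => exact M.bConjFrom A B C
  | bDisjTo A B C => exact M.bDisjTo A B C
  | bDisjFrom A B C => exact M.bDisjFrom A B C
  | cConj A B => exact M.cConj A B
  | cDisj A B => exact M.cDisj A B
  | d A B C => exact M.d A B C

theorem GSp.start (A : Form P) : ∀ (π : List Dir) (q r : P),
    A.subAt π = some (Form.letter q ⋎ Form.letter r) →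
    ∃ u v : Pos A, GSp u v (𝟙 A) ∧ u.idx = A.offsetAt π ∧ v.idx = A.offsetAt π + 1 := by
  induction A with
  | letter p => 
    intro π q r h
    cases π <;> simp [Form.subAt] at h
  | conj A B ihA ihB =>
    intro π q r h
    rcases π with _ | ⟨_ | _, π⟩
    · simp [Form.subAt] at h
    · obtain ⟨u, v, h1, h2, h3⟩ := ihA π q r (by simpa [Form.subAt] using h)
      exact ⟨.cl u, .cl v, (h1.cL B).cast (by simp), by simp [Pos.idx, Form.offsetAt, h2],
        by simp [Pos.idx, Form.offsetAt, h3]⟩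
    · obtain ⟨u, v, h1, h2, h3⟩ := ihB π q r (by simpa [Form.subAt] using h)
      exact ⟨.cr u, .cr v, (h1.cR A).cast (by simp), by simp [Pos.idx, Form.offsetAt, h2],
        by simp [Pos.idx, Form.offsetAt, h3, add_assoc]⟩
  | disj A B ihA ihB =>
    intro π q r h
    rcases π with _ | ⟨_ | _, π⟩
    · simp only [Form.subAt, Option.some.injEq, Form.disj.injEq] at h
      obtain ⟨rfl, rfl⟩ := h
      exact ⟨_, _, GSp.root (GSh.nil q r), rfl, rfl⟩
    · obtain ⟨u, v, h1, h2, h3⟩ := ihA π q r (by simpa [Form.subAt] using h)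
      exact ⟨.dl u, .dl v, (h1.dL B).cast (by simp), by simp [Pos.idx, Form.offsetAt, h2],
        by simp [Pos.idx, Form.offsetAt, h3]⟩
    · obtain ⟨u, v, h1, h2, h3⟩ := ihB π q r (by simpa [Form.subAt] using h)
      exact ⟨.dr u, .dr v, (h1.dR A).cast (by simp), by simp [Pos.idx, Form.offsetAt, h2],
        by simp [Pos.idx, Form.offsetAt, h3, add_assoc]⟩

end GSPsec

open CategoryTheory
section Extsec
variable {P : Type}

def Ctx.at {X : Form P} : ∀ Z : Ctx P, Pos X → Pos (Z.fill X)
  | .hole, x => x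
  | .conjL Z _, x => .cl (Z.at x)
  | .conjR _ Z, x => .cr (Z.at x)
  | .disjL Z _, x => .dl (Z.at x)
  | .disjR _ Z, x => .dr (Z.at x)

theorem Ctx.at_idx {X : Form P} (Z : Ctx P) (x : Pos X) : (Z.at x).idx = Z.offset + x.idx := by
  induction Z with
  | hole => exact (Nat.zero_add _).symm
  | conjL Z C ih => exact ih
  | conjR C Z ih => exact (congrArg (C.size + ·) ih).trans (Nat.add_assoc _ _ _).symm
  | disjL Z C ih => exact ih
  | disjR C Z ih => exact (congrArg (C.size + ·) ih).trans (Nat.add_assoc _ _ _).symm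

theorem Ctx.map_at {X Y : Form P} (Z : Ctx P) (f : Term P X Y) (x : Pos X) :
    (Z.fillArrow f).map (Z.at x) = Z.at (f.map x) := by
  induction Z with
  | hole => rfl
  | conjL Z C ih => exact congrArg Pos.cl ih
  | conjR C Z ih => exact congrArg Pos.cr ih
  | disjL Z C ih => exact congrArg Pos.dl ih
  | disjR C Z ih => exact congrArg Pos.dr ih

def Pos.letter : ∀ {A : Form P}, Pos A → P
  | _, .here p => p
  | _, .cl x => x.letter
  | _, .cr x => x.letter
  | _, .dl x => x.letter
  | _, .dr x => x.letter

theorem Pos.letterAt {A : Form P} (x : Pos A) : A.letterAt x.idx = some x.letter := by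
  induction x with
  | here p => rfl
  | cl x ih => simp only [Form.letterAt, Pos.idx, x.idx_lt, if_true]; exact ih
  | dl x ih => simp only [Form.letterAt, Pos.idx, x.idx_lt, if_true]; exact ih
  | cr x ih => simp [Form.letterAt, Pos.idx]; exact ih
  | dr x ih => simp [Form.letterAt, Pos.idx]; exact ih

theorem Ctx.at_letter {X : Form P} (Z : Ctx P) (x : Pos X) : (Z.at x).letter = x.letter := by
  induction Z with
  | hole => rfl
  | conjL Z C ih => exact ih
  | conjR C Z ih => exact ih
  | disjL Z C ih => exact ih
  | disjR C Z ih => exact ih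

theorem Term.map_letter {A B : Form P} (f : Term P A B) : ∀ x, (f.map x).letter = x.letter := by
  induction f with
  | id A => intro x; rfl
  | comp g f ihg ihf => intro x; exact (ihg _).trans (ihf x)
  | conj f g ihf ihg => intro x; cases x with
    | cl x => exact ihf x
    | cr x => exact ihg x
  | disj f g ihf ihg => intro x; cases x with
    | dl x => exact ihf x
    | dr x => exact ihg x
  | bConjTo => intro x; rcases x with _ | x | (_ | x | x) <;> rfl
  | bConjFrom => intro x; rcases x with _ | (_ | x | x) | x <;> rfl
  | bDisjTo => intro x; rcases x with _ | _ | _ | x | (_ | _ | _ | x | x) <;> rfl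
  | bDisjFrom => intro x; rcases x with _ | _ | _ | (_ | _ | _ | x | x) | x <;> rfl
  | cConj => intro x; cases x <;> rfl
  | cDisj => intro x; cases x <;> rfl
  | d => intro x; rcases x with _ | x | (_ | _ | _ | x | x) <;> rfl

/-- `w` and `u` are the two letters of an occurrence of `p ∧ q`. -/
def PQ (p q : P) : ∀ {B : Form P}, Pos B → Pos B → Prop
  | _, .cl w, .cl u => PQ p q w u
  | _, .cr w, .cr u => PQ p q w u
  | _, .dl w, .dl u => PQ p q w u
  | _, .dr w, .dr u => PQ p q w u
  | _, @Pos.cl _ A C _, .cr _ => A = .letter p ∧ C = .letter q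
  | _, .cr _, .cl _ => False
  | _, .dl _, .dr _ => False
  | _, .dr _, .dl _ => False
  | _, .here _, .here _ => False

theorem PQ.start (A : Form P) : ∀ (π : List Dir) (p q : P),
    A.subAt π = some (Form.letter p ⋏ Form.letter q) →
    ∃ u v : Pos A, PQ p q u v ∧ u.idx = A.offsetAt π ∧ v.idx = A.offsetAt π + 1 := by
  induction A with
  | letter p => 
    intro π q r h
    cases π <;> simp [Form.subAt] at h
  | disj A B ihA ihB =>
    intro π q r h
    rcases π with _ | ⟨_ | _, π⟩
    · simp [Form.subAt] at h
    · obtain ⟨u, v, h1, h2, h3⟩ := ihA π q r (by simpa [Form.subAt] using h)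
      exact ⟨.dl u, .dl v, h1, by simp [Pos.idx, Form.offsetAt, h2],
        by simp [Pos.idx, Form.offsetAt, h3]⟩
    · obtain ⟨u, v, h1, h2, h3⟩ := ihB π q r (by simpa [Form.subAt] using h)
      exact ⟨.dr u, .dr v, h1, by simp [Pos.idx, Form.offsetAt, h2],
        by simp [Pos.idx, Form.offsetAt, h3, add_assoc]⟩
  | conj A B ihA ihB =>
    intro π q r h
    rcases π with _ | ⟨_ | _, π⟩
    · simp only [Form.subAt, Option.some.injEq, Form.conj.injEq] at h
      obtain ⟨rfl, rfl⟩ := h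
      exact ⟨.cl (.here q), .cr (.here r), ⟨rfl, rfl⟩, rfl, rfl⟩
    · obtain ⟨u, v, h1, h2, h3⟩ := ihA π q r (by simpa [Form.subAt] using h)
      exact ⟨.cl u, .cl v, h1, by simp [Pos.idx, Form.offsetAt, h2],
        by simp [Pos.idx, Form.offsetAt, h3]⟩
    · obtain ⟨u, v, h1, h2, h3⟩ := ihB π q r (by simpa [Form.subAt] using h)
      exact ⟨.cr u, .cr v, h1, by simp [Pos.idx, Form.offsetAt, h2],
        by simp [Pos.idx, Form.offsetAt, h3, add_assoc]⟩

/-- The arrow factors through a `d`-term with the marked letters in its head. -/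
def Extr (p q : P) {B S : Form P} (w u v : Pos B) (K : S ⟶ B) : Prop :=
  ∃ (Z : Ctx P) (r : P) (fx : S ⟶ Z.fill (Form.letter p ⋏ (Form.letter q ⋎ Form.letter r)))
    (fy : Term P (Z.fill ((Form.letter p ⋏ Form.letter q) ⋎ Form.letter r)) B),
    K = fx ≫ (Z.fillArrow (Term.d (Form.letter p) (Form.letter q) (Form.letter r))).cls ≫ fy.cls ∧
    fy.map (Z.at (.dl (.cl (.here p)))) = w ∧ fy.map (Z.at (.dl (.cr (.here q)))) = u ∧
    fy.map (Z.at (.dr (.here r))) = v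

section
variable {p q : P} {B S : Form P} {w u v : Pos B} {K : S ⟶ B}

theorem Extr.cast {K' : S ⟶ B} (h : Extr p q w u v K) (e : K' = K) : Extr p q w u v K' := by
  rw [e]; exact h
theorem Extr.pre {S' : Form P} (t : S' ⟶ S) (h : Extr p q w u v K) : Extr p q w u v (t ≫ K) := by
  obtain ⟨Z, r, fx, fy, rfl, h1, h2, h3⟩ := h
  exact ⟨Z, r, t ≫ fx, fy, by simp, h1, h2, h3⟩
theorem Extr.post {B' : Form P} (g : Term P B B') (h : Extr p q w u v K) :
    Extr p q (g.map w) (g.map u) (g.map v) (K ≫ g.cls) := by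
  obtain ⟨Z, r, fx, fy, rfl, rfl, rfl, rfl⟩ := h
  exact ⟨Z, r, fx, g ⬝ fy, by simp [cls_comp], rfl, rfl, rfl⟩
theorem Extr.cL (C : Form P) (h : Extr p q w u v K) :
    Extr p q (Pos.cl w) (Pos.cl u) (Pos.cl v) (cj K (𝟙 C)) := by
  obtain ⟨Z, r, fx, fy, rfl, rfl, rfl, rfl⟩ := h
  refine ⟨.conjL Z C, r, cj fx (𝟙 C), fy ⊼ Term.id C, ?_, rfl, rfl, rfl⟩
  rw [cj_comp_left, cj_comp_left]; rfl
theorem Extr.cR (C : Form P) (h : Extr p q w u v K) :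
    Extr p q (Pos.cr w) (Pos.cr u) (Pos.cr v) (cj (𝟙 C) K) := by
  obtain ⟨Z, r, fx, fy, rfl, rfl, rfl, rfl⟩ := h
  refine ⟨.conjR C Z, r, cj (𝟙 C) fx, Term.id C ⊼ fy, ?_, rfl, rfl, rfl⟩
  rw [cj_comp_right, cj_comp_right]; rfl
theorem Extr.dL (C : Form P) (h : Extr p q w u v K) :
    Extr p q (Pos.dl w) (Pos.dl u) (Pos.dl v) (dj K (𝟙 C)) := by
  obtain ⟨Z, r, fx, fy, rfl, rfl, rfl, rfl⟩ := h
  refine ⟨.disjL Z C, r, dj fx (𝟙 C), fy ⊽ Term.id C, ?_, rfl, rfl, rfl⟩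
  rw [dj_comp_left, dj_comp_left]; rfl
theorem Extr.dR (C : Form P) (h : Extr p q w u v K) :
    Extr p q (Pos.dr w) (Pos.dr u) (Pos.dr v) (dj (𝟙 C) K) := by
  obtain ⟨Z, r, fx, fy, rfl, rfl, rfl, rfl⟩ := h
  refine ⟨.disjR C Z, r, dj (𝟙 C) fx, Term.id C ⊽ fy, ?_, rfl, rfl, rfl⟩
  rw [dj_comp_right, dj_comp_right]; rfl
end

/-- Term for `del`. -/
def delT (s V x : Form P) : Term P (s ⋏ (V ⋎ x)) (V ⋎ (s ⋏ x)) :=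
  Term.cDisj V (s ⋏ x) ⬝ (Term.d s x V ⬝ (Term.id s ⊼ Term.cDisj x V))
theorem delT_cls (s V x : Form P) : (delT s V x).cls = del s V x := by
  unfold del delT
  simp only [cls_comp, Category.assoc]; rfl
/-- Term for `sig`. -/
def sigT (E V x : Form P) : Term P (E ⋎ (V ⋎ x)) (V ⋎ (E ⋎ x)) :=
  Term.bDisjFrom V E x ⬝ ((Term.cDisj V E ⊽ Term.id x) ⬝ Term.bDisjTo E V x)
theorem sigT_cls (s V x : Form P) : (sigT s V x).cls = sig s V x := by
  unfold sig sigT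
  simp only [cls_comp, Category.assoc]; rfl

section
variable {p q : P} {Y W S : Form P} {w u : Pos Y} {v : Pos W}

theorem Extr.wC {K : S ⟶ Y ⋎ W} (s : Form P) (h : Extr p q (.dl w) (.dl u) (.dr v) K) :
    Extr p q (.dl w) (.dl u) (.dr (.cr v)) (cj (𝟙 s) K ≫ del s Y W) :=
  ((h.cR s).post (delT s Y W)).cast (by rw [delT_cls])
theorem Extr.wD {K : S ⟶ Y ⋎ W} (s : Form P) (h : Extr p q (.dl w) (.dl u) (.dr v) K) :
    Extr p q (.dl w) (.dl u) (.dr (.dr v)) (dj (𝟙 s) K ≫ sig s Y W) :=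
  ((h.dR s).post (sigT s Y W)).cast (by rw [sigT_cls])
theorem Extr.wCf {s : Form P} {K : S ⟶ Y ⋎ (s ⋏ W)}
    (h : Extr p q (.dl w) (.dl u) (.dr (.cr v)) K) :
    Extr p q (.dl w) (.dl u) (.dr (.cl v)) (K ≫ dj (𝟙 Y) (ca s W)) :=
  h.post (Term.id Y ⊽ Term.cConj s W)
theorem Extr.wDf {s : Form P} {K : S ⟶ Y ⋎ (s ⋎ W)}
    (h : Extr p q (.dl w) (.dl u) (.dr (.dr v)) K) :
    Extr p q (.dl w) (.dl u) (.dr (.dl v)) (K ≫ dj (𝟙 Y) (co s W)) :=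
  h.post (Term.id Y ⊽ Term.cDisj W s)
end

theorem extBase (p q : P) {W S : Form P} {v : Pos W} {K : S ⟶ Form.letter q ⋎ W}
    (h : GSh (Pos.here q) v K) :
    Extr p q (.dl (.cl (.here p))) (.dl (.cr (.here q))) (.dr v)
      (cj (𝟙 (Form.letter p)) K ≫ dd (Form.letter p) (Form.letter q) W) := by
  refine h.elim (fun W S v K => Extr p q (.dl (.cl (.here p))) (.dl (.cr (.here q))) (.dr v)
      (cj (𝟙 (Form.letter p)) K ≫ dd (Form.letter p) (Form.letter q) W)) ⟨?_, ?_, ?_, ?_, ?_⟩ ?_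
  · intro W S S' v K t h
    exact (h.pre (cj (𝟙 _) t)).cast (by rw [cj_comp_right]; simp)
  · intro W S v K z h
    refine ((h.wC z).pre (tau _ z _)).cast ?_
    simp only [cj_comp_right, Category.assoc]
    rw [Xcc, ← reassoc_of% tau_cj]
  · intro W S v K z h
    refine ((h.wD z).pre (del _ z _)).cast ?_
    simp only [dj_comp_right, cj_comp_right, Category.assoc]
    rw [L5, reassoc_of% del_nat]
  · intro s W S v K h
    refine h.wCf.cast ?_
    simp only [cj_comp_right, Category.assoc]
    rw [← dd_nat]; simp
  · intro s W S v K h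
    refine h.wDf.cast ?_
    simp only [cj_comp_right, Category.assoc]
    rw [← dd_nat]; simp
  · intro r
    refine ⟨.hole, r, 𝟙 _, Term.id _, ?_, rfl, rfl, rfl⟩
    rw [cj_id]
    change _ = 𝟙 _ ≫ dd _ _ _ ≫ 𝟙 _
    rw [Category.comp_id]

theorem GSh.ext {p q : P} {Y W S : Form P} {u : Pos Y} {v : Pos W} {K : S ⟶ Y ⋎ W}
    (h : GSh u v K) : ∀ w, PQ p q w u → Extr p q (.dl w) (.dl u) (.dr v) K := by
  induction h with
  | nil q r => intro w hw; cases w; exact hw.elim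
  | pre t _ ih => intro w hw; exact (ih w hw).pre t
  | @yC Y W S u v K s h ih =>
    intro w hw
    cases w with
    | cl w =>
      obtain ⟨rfl, rfl⟩ := hw
      cases u; cases w
      exact extBase p q h
    | cr w => exact ((ih w hw).cR s).post (Term.d s Y W)
  | @yD Y W S u v K s h ih =>
    intro w hw
    cases w with
    | dl w => exact hw.elim
    | dr w => exact ((ih w hw).dR s).post (Term.bDisjTo s Y W)
  | @yCf s Y W S u v K h ih =>
    intro w hw
    cases w with
    | cl w => exact (ih (.cr w) hw).post (Term.cConj s Y ⊽ Term.id W)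
    | cr w => exact hw.elim
  | @yDf s Y W S u v K h ih =>
    intro w hw
    cases w with
    | dl w => exact (ih (.dr w) hw).post (Term.cDisj Y s ⊽ Term.id W)
    | dr w => exact hw.elim
  | wC s _ ih => intro w hw; exact (ih w hw).wC s
  | wD s _ ih => intro w hw; exact (ih w hw).wD s
  | wCf _ ih => intro w hw; exact (ih w hw).wCf
  | wDf _ ih => intro w hw; exact (ih w hw).wDf

theorem GSp.ext {p q : P} {B S : Form P} {u v : Pos B} {K : S ⟶ B}
    (h : GSp u v K) : ∀ w, PQ p q w u → Extr p q w u v K := by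
  induction h with
  | pre t _ ih => intro w hw; exact (ih w hw).pre t
  | root h =>
    intro w hw
    cases w with
    | dl w => exact h.ext w hw
    | dr w => exact hw.elim
  | @root' Y W S u v K h =>
    intro w hw
    cases w with
    | dl w => exact hw.elim
    | dr w => exact ((h.swap.ext w hw).post (Term.cDisj Y W)).cast (by
        change K = (K ≫ co Y W) ≫ co W Y
        simp)
  | @cL B S u v K C h ih =>
    intro w hw
    cases w with
    | cl w => exact (ih w hw).cL C
    | cr w => exact hw.elim
  | @cR B S u v K C h ih =>
    intro w hw
    cases w with
    | cr w => exact (ih w hw).cR C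
    | cl w =>
      obtain ⟨rfl, rfl⟩ := hw
      cases u; cases v
      exact h.inv.elim
  | @dL B S u v K C h ih =>
    intro w hw
    cases w with
    | dl w => exact (ih w hw).dL C
    | dr w => exact hw.elim
  | @dR B S u v K C h ih =>
    intro w hw
    cases w with
    | dr w => exact (ih w hw).dR C
    | dl w => exact hw.elim

end Extsec

/-- **p-q-r Lemma**: let `f : A ⊢ B` be an arrow of DS, let `x₁, x₂, x₃` be
occurrences of the letters `p, q, r` respectively in `A` and `y₁, y₂, y₃`
occurrences of `p, q, r` respectively in `B`, such that `x_i` and `y_i` are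
linked in `f`.  Suppose moreover that `x₂ ∨ x₃` is a subformula occurrence of `A`
and `y₁ ∧ y₂` is a subformula occurrence of `B`.  Then there is a `d_{p,q,r}`-term
`h : A′ ⊢ B′` (given by a context `Z` with head `d_{p,q,r}`), with `x′_i` the
occurrences of `p, q, r` in the source `p∧(q∨r)` of the head of `h` and `y′_i`
the occurrences of `p, q, r` in the target `(p∧q)∨r` of the head of `h`, and
there are arrows `f_x : A ⊢ A′` and `f_y : B′ ⊢ B` of DS, such that
`f = f_y ∘ h ∘ f_x` in DS, `x_i` is linked to `x′_i` in `f_x`, and `y′_i` is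
linked to `y_i` in `f_y`. -/
theorem pqr_lemma {P : Type} {A B : Form P} (f : Term P A B) (p q r : P)
    (n₁ n₂ n₃ m₁ m₂ m₃ : ℕ)
    (hA₁ : A.letterAt n₁ = some p) (hA₂ : A.letterAt n₂ = some q)
    (hA₃ : A.letterAt n₃ = some r)
    (hB₁ : B.letterAt m₁ = some p) (hB₂ : B.letterAt m₂ = some q)
    (hB₃ : B.letterAt m₃ = some r)
    (hl₁ : Linked f n₁ m₁) (hl₂ : Linked f n₂ m₂) (hl₃ : Linked f n₃ m₃)
    (hsubA : ∃ π : List Dir, A.subAt π = some (Form.letter q ⋎ Form.letter r) ∧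
      n₂ = A.offsetAt π ∧ n₃ = A.offsetAt π + 1)
    (hsubB : ∃ ρ : List Dir, B.subAt ρ = some (Form.letter p ⋏ Form.letter q) ∧
      m₁ = B.offsetAt ρ ∧ m₂ = B.offsetAt ρ + 1) :
    ∃ (Z : Ctx P)
      (fx : Term P A (Z.fill (Form.letter p ⋏ (Form.letter q ⋎ Form.letter r))))
      (fy : Term P (Z.fill ((Form.letter p ⋏ Form.letter q) ⋎ Form.letter r)) B),
      Eqv f (fy ⬝ (Z.fillArrow (Term.d (Form.letter p) (Form.letter q) (Form.letter r)) ⬝ fx)) ∧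
      Linked fx n₁ Z.offset ∧ Linked fx n₂ (Z.offset + 1) ∧ Linked fx n₃ (Z.offset + 2) ∧
      Linked fy Z.offset m₁ ∧ Linked fy (Z.offset + 1) m₂ ∧ Linked fy (Z.offset + 2) m₃ := by
  obtain ⟨π, hπ, hn₂, hn₃⟩ := hsubA
  obtain ⟨ρ, hρ, hm₁, hm₂⟩ := hsubB
  obtain ⟨x₁, e₁, g₁⟩ := (linked_iff _ _ _).1 hl₁
  obtain ⟨x₂, e₂, g₂⟩ := (linked_iff _ _ _).1 hl₂
  obtain ⟨x₃, e₃, g₃⟩ := (linked_iff _ _ _).1 hl₃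
  obtain ⟨u, v, hG, hu, hv⟩ := GSp.start A π q r hπ
  obtain rfl : u = x₂ := Pos.idx_inj (by omega)
  obtain rfl : v = x₃ := Pos.idx_inj (by omega)
  obtain ⟨w, u', hPQ, hw, hu'⟩ := PQ.start B ρ p q hρ
  obtain rfl : u' = f.map u := Pos.idx_inj (by omega)
  obtain rfl : w = f.map x₁ := Pos.idx_inj (by omega)
  obtain ⟨Z, r', fx, fy, hK, h1, h2, h3⟩ := (M.all f u v _ _ hG).ext _ hPQ
  have hr : r' = r := by
    have l1 := congrArg Pos.letter h3
    rw [Term.map_letter, Ctx.at_letter] at l1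
    have l2 := (f.map v).letterAt
    rw [g₃, hB₃] at l2
    exact l1.trans (Option.some.inj l2).symm
  subst hr
  obtain ⟨fx, rfl⟩ := exists_cls fx
  have hE : Eqv f (fy ⬝ (Z.fillArrow (Term.d (Form.letter p) (Form.letter q) (Form.letter r')) ⬝
      fx)) := by
    apply Term.cls_eq.1
    rw [Category.id_comp] at hK
    rw [hK]
    simp only [cls_comp, Category.assoc]
  have key : ∀ (x : Pos A) y, fy.map (Z.at ((Term.d (Form.letter p) (Form.letter q)
      (Form.letter r')).map y)) = f.map x → fx.map x = Z.at y := by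
    intro x y h
    have := hE.map_eq x
    rw [← h] at this
    apply Term.map_injective (Z.fillArrow (Term.d (Form.letter p) (Form.letter q)
      (Form.letter r')))
    rw [Ctx.map_at]
    exact (Term.map_injective fy this).symm
  have k1 := key x₁ (.cl (.here p)) h1
  have k2 := key u (.cr (.dl (.here q))) h2
  have k3 := key v (.cr (.dr (.here r'))) h3
  refine ⟨Z, fx, fy, hE, (linked_iff _ _ _).2 ⟨x₁, e₁, ?_⟩, (linked_iff _ _ _).2 ⟨u, e₂, ?_⟩,
    (linked_iff _ _ _).2 ⟨v, e₃, ?_⟩, (linked_iff _ _ _).2 ⟨_, ?_, (congrArg Pos.idx h1).trans g₁⟩,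
    (linked_iff _ _ _).2 ⟨_, ?_, (congrArg Pos.idx h2).trans g₂⟩,
    (linked_iff _ _ _).2 ⟨_, ?_, (congrArg Pos.idx h3).trans g₃⟩⟩
  · rw [k1, Ctx.at_idx]; rfl
  · rw [k2, Ctx.at_idx]; rfl
  · rw [k3, Ctx.at_idx]; rfl
  · rw [Ctx.at_idx]; rfl
  · rw [Ctx.at_idx]; rfl
  · rw [Ctx.at_idx]; rfl
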